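/- arXiv:1710.11579 — 4 statements merged into one kernel-verified Lean document; each statement's English description precedes it below -/
import Mathlib

section
/- The K-algebra B admits the smaller presentation of Lemma 2.2: let B' be the associative K-algebra presented by generators 1(n) for n ≥ 0, s_i(n) for 1 ≤ i ≤ n−1, and w(n) for n ≥ 1, subject to the relations 1(n)1(m) = δ_{n,m}1(n), 1(n)s_i(n) = s_i(n)1(n) = s_i(n), s_i(n)s_i(n) = 1(n), s_i(n)s_{i+1}(n)s_i(n) = s_{i+1}(n)s_i(n)s_{i+1}(n), s_i(n)s_j(n) = s_j(n)s_i(n) for |i−j| > 1, 1(n−1)w(n) = w(n)1(n) = w(n), w(n)s_i(n) = s_i(n−1)w(n) for i < n−1, and w(n)w(n+1)s_n(n+1) = w(n)w(n+1). Then the K-algebra homomorphism B' → B determined by 1(n) ↦ 1(n), s_i(n) ↦ s_i(n), and w(n) ↦ v_n(n) is an isomorphism. -/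
/-- Generators of the algebra `B`: the idempotents `1(n)` for `n ≥ 0`, the
crossings `s_i(n)` for `1 ≤ i ≤ n−1`, and the short strands `v_i(n)` for
`1 ≤ i ≤ n`. -/
inductive BGen : Type where
  | one (n : ℕ)
  | s (n i : ℕ) (h1 : 1 ≤ i) (h2 : i + 1 ≤ n)
  | v (n i : ℕ) (h1 : 1 ≤ i) (h2 : i ≤ n)

variable (K : Type) [Field K] [CharZero K]

/-- The defining relations of the algebra `B` (Definition 2.1): relations of
idempotents, relations of symmetric groups, and relations of short strands. -/
inductive BRel : FreeAlgebra K BGen → FreeAlgebra K BGen → Prop where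
  | idem_self (n : ℕ) :
      BRel (FreeAlgebra.ι K (BGen.one n) * FreeAlgebra.ι K (BGen.one n))
        (FreeAlgebra.ι K (BGen.one n))
  | idem_orth (n m : ℕ) (h : n ≠ m) :
      BRel (FreeAlgebra.ι K (BGen.one n) * FreeAlgebra.ι K (BGen.one m)) 0
  | one_s (n i : ℕ) (h1 : 1 ≤ i) (h2 : i + 1 ≤ n) :
      BRel (FreeAlgebra.ι K (BGen.one n) * FreeAlgebra.ι K (BGen.s n i h1 h2))
        (FreeAlgebra.ι K (BGen.s n i h1 h2))
  | s_one (n i : ℕ) (h1 : 1 ≤ i) (h2 : i + 1 ≤ n) :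
      BRel (FreeAlgebra.ι K (BGen.s n i h1 h2) * FreeAlgebra.ι K (BGen.one n))
        (FreeAlgebra.ι K (BGen.s n i h1 h2))
  | one_v (n i : ℕ) (h1 : 1 ≤ i) (h2 : i ≤ n) :
      BRel (FreeAlgebra.ι K (BGen.one (n - 1)) * FreeAlgebra.ι K (BGen.v n i h1 h2))
        (FreeAlgebra.ι K (BGen.v n i h1 h2))
  | v_one (n i : ℕ) (h1 : 1 ≤ i) (h2 : i ≤ n) :
      BRel (FreeAlgebra.ι K (BGen.v n i h1 h2) * FreeAlgebra.ι K (BGen.one n))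
        (FreeAlgebra.ι K (BGen.v n i h1 h2))
  | s_sq (n i : ℕ) (h1 : 1 ≤ i) (h2 : i + 1 ≤ n) :
      BRel (FreeAlgebra.ι K (BGen.s n i h1 h2) * FreeAlgebra.ι K (BGen.s n i h1 h2))
        (FreeAlgebra.ι K (BGen.one n))
  | braid (n i : ℕ) (h1 : 1 ≤ i) (h2 : i + 2 ≤ n) :
      BRel (FreeAlgebra.ι K (BGen.s n i h1 (by omega)) *
          FreeAlgebra.ι K (BGen.s n (i + 1) (by omega) h2) *
          FreeAlgebra.ι K (BGen.s n i h1 (by omega)))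
        (FreeAlgebra.ι K (BGen.s n (i + 1) (by omega) h2) *
          FreeAlgebra.ι K (BGen.s n i h1 (by omega)) *
          FreeAlgebra.ι K (BGen.s n (i + 1) (by omega) h2))
  | s_comm (n i j : ℕ) (hi1 : 1 ≤ i) (hi2 : i + 1 ≤ n) (hj1 : 1 ≤ j) (hj2 : j + 1 ≤ n)
      (h : i + 1 < j) :
      BRel (FreeAlgebra.ι K (BGen.s n i hi1 hi2) * FreeAlgebra.ι K (BGen.s n j hj1 hj2))
        (FreeAlgebra.ι K (BGen.s n j hj1 hj2) * FreeAlgebra.ι K (BGen.s n i hi1 hi2))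
  | v_s_far (n i j : ℕ) (hi1 : 1 ≤ i) (hi2 : i ≤ n) (hj1 : 1 ≤ j) (hj2 : j + 1 ≤ n)
      (h : j + 1 < i) :
      BRel (FreeAlgebra.ι K (BGen.v n i hi1 hi2) * FreeAlgebra.ι K (BGen.s n j hj1 hj2))
        (FreeAlgebra.ι K (BGen.s (n - 1) j hj1 (by omega)) *
          FreeAlgebra.ι K (BGen.v n i hi1 hi2))
  | v_s_near (n i j : ℕ) (hi1 : 1 ≤ i) (hi2 : i ≤ n) (hj1 : 1 ≤ j) (hj2 : j + 1 ≤ n)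
      (h : i < j) :
      BRel (FreeAlgebra.ι K (BGen.v n i hi1 hi2) * FreeAlgebra.ι K (BGen.s n j hj1 hj2))
        (FreeAlgebra.ι K (BGen.s (n - 1) (j - 1) (by omega) (by omega)) *
          FreeAlgebra.ι K (BGen.v n i hi1 hi2))
  | v_v (n i j : ℕ) (hi1 : 1 ≤ i) (hi2 : i ≤ n) (hj1 : 1 ≤ j) (hj2 : j ≤ n + 1)
      (h : j ≤ i) :
      BRel (FreeAlgebra.ι K (BGen.v n i hi1 hi2) * FreeAlgebra.ι K (BGen.v (n + 1) j hj1 hj2))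
        (FreeAlgebra.ι K (BGen.v n j hj1 (by omega)) *
          FreeAlgebra.ι K (BGen.v (n + 1) (i + 1) (by omega) (by omega)))
  | slide (n i : ℕ) (h1 : 1 ≤ i) (h2 : i + 1 ≤ n) :
      BRel (FreeAlgebra.ι K (BGen.v n i h1 (by omega)) * FreeAlgebra.ι K (BGen.s n i h1 h2))
        (FreeAlgebra.ι K (BGen.v n (i + 1) (by omega) h2))

/-- The algebra `B`, as the quotient of the free `K`-algebra on the generators
by the two-sided ideal generated by the relations. -/
abbrev BAlg : Type := RingQuot (BRel K)

/-- The idempotent `1(n) ∈ B`. -/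
def bE (n : ℕ) : BAlg K :=
  RingQuot.mkAlgHom K (BRel K) (FreeAlgebra.ι K (BGen.one n))

/-- The crossing `s_i(n) ∈ B`. -/
def bS (n i : ℕ) (h1 : 1 ≤ i) (h2 : i + 1 ≤ n) : BAlg K :=
  RingQuot.mkAlgHom K (BRel K) (FreeAlgebra.ι K (BGen.s n i h1 h2))

/-- The short strand `v_i(n) ∈ B`. -/
def bV (n i : ℕ) (h1 : 1 ≤ i) (h2 : i ≤ n) : BAlg K :=
  RingQuot.mkAlgHom K (BRel K) (FreeAlgebra.ι K (BGen.v n i h1 h2))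

/-- The component `B(m,n) = 1(m)·B·1(n)`. -/
def Bspace (m n : ℕ) : Submodule K (BAlg K) :=
  LinearMap.range ((LinearMap.mulLeft K (bE K m)).comp (LinearMap.mulRight K (bE K n)))

/-- Generators of the algebra `B'` of Lemma 2.2: `1(n)`, `s_i(n)` for
`1 ≤ i ≤ n−1`, and `w(n)` (playing the role of `v_n(n)`) for `n ≥ 1`. -/
inductive BGen' : Type where
  | one (n : ℕ)
  | s (n i : ℕ) (h1 : 1 ≤ i) (h2 : i + 1 ≤ n)
  | w (n : ℕ) (h : 1 ≤ n)

/-- The defining relations of `B'` (Lemma 2.2). -/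
inductive BRel' : FreeAlgebra K BGen' → FreeAlgebra K BGen' → Prop where
  | idem_self (n : ℕ) :
      BRel' (FreeAlgebra.ι K (BGen'.one n) * FreeAlgebra.ι K (BGen'.one n))
        (FreeAlgebra.ι K (BGen'.one n))
  | idem_orth (n m : ℕ) (h : n ≠ m) :
      BRel' (FreeAlgebra.ι K (BGen'.one n) * FreeAlgebra.ι K (BGen'.one m)) 0
  | one_s (n i : ℕ) (h1 : 1 ≤ i) (h2 : i + 1 ≤ n) :
      BRel' (FreeAlgebra.ι K (BGen'.one n) * FreeAlgebra.ι K (BGen'.s n i h1 h2))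
        (FreeAlgebra.ι K (BGen'.s n i h1 h2))
  | s_one (n i : ℕ) (h1 : 1 ≤ i) (h2 : i + 1 ≤ n) :
      BRel' (FreeAlgebra.ι K (BGen'.s n i h1 h2) * FreeAlgebra.ι K (BGen'.one n))
        (FreeAlgebra.ι K (BGen'.s n i h1 h2))
  | s_sq (n i : ℕ) (h1 : 1 ≤ i) (h2 : i + 1 ≤ n) :
      BRel' (FreeAlgebra.ι K (BGen'.s n i h1 h2) * FreeAlgebra.ι K (BGen'.s n i h1 h2))
        (FreeAlgebra.ι K (BGen'.one n))
  | braid (n i : ℕ) (h1 : 1 ≤ i) (h2 : i + 2 ≤ n) :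
      BRel' (FreeAlgebra.ι K (BGen'.s n i h1 (by omega)) *
          FreeAlgebra.ι K (BGen'.s n (i + 1) (by omega) h2) *
          FreeAlgebra.ι K (BGen'.s n i h1 (by omega)))
        (FreeAlgebra.ι K (BGen'.s n (i + 1) (by omega) h2) *
          FreeAlgebra.ι K (BGen'.s n i h1 (by omega)) *
          FreeAlgebra.ι K (BGen'.s n (i + 1) (by omega) h2))
  | s_comm (n i j : ℕ) (hi1 : 1 ≤ i) (hi2 : i + 1 ≤ n) (hj1 : 1 ≤ j) (hj2 : j + 1 ≤ n)
      (h : i + 1 < j) :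
      BRel' (FreeAlgebra.ι K (BGen'.s n i hi1 hi2) * FreeAlgebra.ι K (BGen'.s n j hj1 hj2))
        (FreeAlgebra.ι K (BGen'.s n j hj1 hj2) * FreeAlgebra.ι K (BGen'.s n i hi1 hi2))
  | one_w (n : ℕ) (h : 1 ≤ n) :
      BRel' (FreeAlgebra.ι K (BGen'.one (n - 1)) * FreeAlgebra.ι K (BGen'.w n h))
        (FreeAlgebra.ι K (BGen'.w n h))
  | w_one (n : ℕ) (h : 1 ≤ n) :
      BRel' (FreeAlgebra.ι K (BGen'.w n h) * FreeAlgebra.ι K (BGen'.one n))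
        (FreeAlgebra.ι K (BGen'.w n h))
  | w_s (n i : ℕ) (h : 1 ≤ n) (h1 : 1 ≤ i) (h2 : i + 1 < n) :
      BRel' (FreeAlgebra.ι K (BGen'.w n h) * FreeAlgebra.ι K (BGen'.s n i h1 (by omega)))
        (FreeAlgebra.ι K (BGen'.s (n - 1) i h1 (by omega)) * FreeAlgebra.ι K (BGen'.w n h))
  | symmetric (n : ℕ) (h : 1 ≤ n) :
      BRel' (FreeAlgebra.ι K (BGen'.w n h) * FreeAlgebra.ι K (BGen'.w (n + 1) (by omega)) *
          FreeAlgebra.ι K (BGen'.s (n + 1) n h (by omega)))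
        (FreeAlgebra.ι K (BGen'.w n h) * FreeAlgebra.ι K (BGen'.w (n + 1) (by omega)))

/-- The algebra `B'` of Lemma 2.2. -/
abbrev BAlg' : Type := RingQuot (BRel' K)

/-- The idempotent `1(n) ∈ B'`. -/
def bE' (n : ℕ) : BAlg' K :=
  RingQuot.mkAlgHom K (BRel' K) (FreeAlgebra.ι K (BGen'.one n))

/-- The crossing `s_i(n) ∈ B'`. -/
def bS' (n i : ℕ) (h1 : 1 ≤ i) (h2 : i + 1 ≤ n) : BAlg' K :=
  RingQuot.mkAlgHom K (BRel' K) (FreeAlgebra.ι K (BGen'.s n i h1 h2))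

/-- The generator `w(n) ∈ B'`. -/
def bW (n : ℕ) (h : 1 ≤ n) : BAlg' K :=
  RingQuot.mkAlgHom K (BRel' K) (FreeAlgebra.ι K (BGen'.w n h))

section SmallerPresentation

variable (F : Type) [Field F]

/-- The crossing `s_i(n) ∈ B'`, extended by zero outside the range `1 ≤ i ≤ n - 1`. -/
noncomputable def crossing (n i : ℕ) : BAlg' F :=
  if h : 1 ≤ i ∧ i + 1 ≤ n then bS' F n i h.1 h.2 else 0

/-- The generator `w(n) ∈ B'`, extended by zero to `n = 0`. -/
noncomputable def lastStrand (n : ℕ) : BAlg' F :=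
  if h : 1 ≤ n then bW F n h else 0

/-- The product `w(n) s_{n-1}(n) ⋯ s_{n-k}(n)` in `B'`. -/
noncomputable def strandProd (n : ℕ) : ℕ → BAlg' F
  | 0 => lastStrand F n
  | k + 1 => strandProd n k * crossing F n (n - (k + 1))

/-- The element `w(n) s_{n-1}(n) ⋯ s_i(n)` of `B'`, which corresponds to `v_i(n)`. -/
noncomputable def shortStrand (n i : ℕ) : BAlg' F :=
  strandProd F n (n - i)

variable {F}

lemma crossing_eq {n i : ℕ} (h1 : 1 ≤ i) (h2 : i + 1 ≤ n) :
    crossing F n i = bS' F n i h1 h2 :=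
  dif_pos ⟨h1, h2⟩

lemma lastStrand_eq {n : ℕ} (h : 1 ≤ n) : lastStrand F n = bW F n h :=
  dif_pos h

lemma shortStrand_self (n : ℕ) : shortStrand F n n = lastStrand F n := by
  simp [shortStrand, strandProd]

lemma shortStrand_of_lt {n i : ℕ} (h : i < n) :
    shortStrand F n i = shortStrand F n (i + 1) * crossing F n i := by
  obtain ⟨k, rfl⟩ := Nat.exists_eq_add_of_lt h
  have e₁ : i + k + 1 - i = k + 1 := by omega
  have e₂ : i + k + 1 - (i + 1) = k := by omega
  have e₃ : i + k + 1 - (k + 1) = i := by omega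
  simp only [shortStrand, e₁, e₂, strandProd, e₃]

lemma crossing_mul_idem {n i : ℕ} (h1 : 1 ≤ i) (h2 : i + 1 ≤ n) :
    crossing F n i * bE' F n = crossing F n i := by
  rw [crossing_eq h1 h2, bS', bE', ← map_mul]
  exact RingQuot.mkAlgHom_rel F (.s_one n i h1 h2)

lemma crossing_sq {n i : ℕ} (h1 : 1 ≤ i) (h2 : i + 1 ≤ n) :
    crossing F n i * crossing F n i = bE' F n := by
  rw [crossing_eq h1 h2, bS', bE', ← map_mul]
  exact RingQuot.mkAlgHom_rel F (.s_sq n i h1 h2)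

lemma crossing_braid {n i : ℕ} (h1 : 1 ≤ i) (h2 : i + 2 ≤ n) :
    crossing F n i * crossing F n (i + 1) * crossing F n i =
      crossing F n (i + 1) * crossing F n i * crossing F n (i + 1) := by
  rw [crossing_eq h1 (by omega), crossing_eq (by omega) h2]
  simp only [bS', ← map_mul]
  exact RingQuot.mkAlgHom_rel F (.braid n i h1 h2)

lemma crossing_comm {n i j : ℕ} (h1 : 1 ≤ i) (h2 : j + 1 ≤ n) (h : i + 1 < j) :
    crossing F n i * crossing F n j = crossing F n j * crossing F n i := by
  rw [crossing_eq h1 (by omega), crossing_eq (by omega) h2]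
  simp only [bS', ← map_mul]
  exact RingQuot.mkAlgHom_rel F (.s_comm n i j h1 (by omega) (by omega) h2 h)

lemma idem_mul_lastStrand {n : ℕ} (h : 1 ≤ n) :
    bE' F (n - 1) * lastStrand F n = lastStrand F n := by
  rw [lastStrand_eq h, bE', bW, ← map_mul]
  exact RingQuot.mkAlgHom_rel F (.one_w n h)

lemma lastStrand_mul_idem {n : ℕ} (h : 1 ≤ n) :
    lastStrand F n * bE' F n = lastStrand F n := by
  rw [lastStrand_eq h, bE', bW, ← map_mul]
  exact RingQuot.mkAlgHom_rel F (.w_one n h)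

lemma lastStrand_mul_crossing {n i : ℕ} (h1 : 1 ≤ i) (h2 : i + 1 < n) :
    lastStrand F n * crossing F n i = crossing F (n - 1) i * lastStrand F n := by
  rw [lastStrand_eq (by omega), crossing_eq h1 (by omega), crossing_eq h1 (by omega)]
  simp only [bW, bS', ← map_mul]
  exact RingQuot.mkAlgHom_rel F (.w_s n i (by omega) h1 h2)

lemma lastStrand_mul_lastStrand_mul_crossing {n : ℕ} (h : 1 ≤ n) :
    lastStrand F n * lastStrand F (n + 1) * crossing F (n + 1) n =
      lastStrand F n * lastStrand F (n + 1) := by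
  rw [lastStrand_eq h, lastStrand_eq (by omega), crossing_eq h (by omega)]
  simp only [bW, bS', ← map_mul]
  exact RingQuot.mkAlgHom_rel F (.symmetric n h)

lemma idem_mul_shortStrand {n i : ℕ} (h1 : 1 ≤ i) (h2 : i ≤ n) :
    bE' F (n - 1) * shortStrand F n i = shortStrand F n i := by
  induction h2 using Nat.decreasingInduction with
  | self => rw [shortStrand_self, idem_mul_lastStrand h1]
  | of_succ i hi ih => rw [shortStrand_of_lt hi, ← mul_assoc, ih (by omega)]

lemma shortStrand_mul_idem {n i : ℕ} (h1 : 1 ≤ i) (h2 : i ≤ n) :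
    shortStrand F n i * bE' F n = shortStrand F n i := by
  obtain rfl | h := h2.eq_or_lt
  · rw [shortStrand_self, lastStrand_mul_idem h1]
  · rw [shortStrand_of_lt h, mul_assoc, crossing_mul_idem h1 h]

lemma shortStrand_mul_crossing_self {n i : ℕ} (h1 : 1 ≤ i) (h2 : i < n) :
    shortStrand F n i * crossing F n i = shortStrand F n (i + 1) := by
  rw [shortStrand_of_lt h2, mul_assoc, crossing_sq h1 h2,
    shortStrand_mul_idem (by omega) h2]

lemma shortStrand_mul_crossing_of_gt {n i j : ℕ} (hj : 1 ≤ j) (h : j + 1 < i) (hi : i ≤ n) :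
    shortStrand F n i * crossing F n j = crossing F (n - 1) j * shortStrand F n i := by
  induction hi using Nat.decreasingInduction with
  | self => rw [shortStrand_self, lastStrand_mul_crossing hj h]
  | of_succ i hi ih =>
    rw [shortStrand_of_lt hi, mul_assoc, ← crossing_comm hj hi h, ← mul_assoc,
      ih (by omega), mul_assoc]

lemma shortStrand_mul_crossing_of_lt {n i j : ℕ} (hi : 1 ≤ i) (h : i < j) (hj : j + 1 ≤ n) :
    shortStrand F n i * crossing F n j = crossing F (n - 1) (j - 1) * shortStrand F n i := by
  obtain ⟨j, rfl⟩ : ∃ k, j = k + 1 := ⟨j - 1, by omega⟩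
  rw [Nat.add_sub_cancel]
  induction Nat.le_of_lt_succ h using Nat.decreasingInduction with
  | self =>
    rw [shortStrand_of_lt (by omega), shortStrand_of_lt (by omega),
      mul_assoc (shortStrand F n _), mul_assoc (shortStrand F n _), ← crossing_braid hi hj,
      mul_assoc (crossing F n j), ← mul_assoc (shortStrand F n _) (crossing F n j),
      shortStrand_mul_crossing_of_gt hi (by omega) hj]
    simp only [mul_assoc]
  | of_succ i hij ih =>
    rw [shortStrand_of_lt (by omega), mul_assoc, crossing_comm hi hj (by omega), ← mul_assoc,
      ih (by omega) (by omega), mul_assoc]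

lemma shortStrand_mul_shortStrand_same {n i : ℕ} (h1 : 1 ≤ i) (h2 : i ≤ n) :
    shortStrand F n i * shortStrand F (n + 1) i =
      shortStrand F n i * shortStrand F (n + 1) (i + 1) := by
  induction h2 using Nat.decreasingInduction with
  | self =>
    rw [shortStrand_of_lt (Nat.lt_succ_self n), shortStrand_self, shortStrand_self, ← mul_assoc,
      lastStrand_mul_lastStrand_mul_crossing h1]
  | of_succ i hi ih =>
    have key : shortStrand F n i * shortStrand F (n + 1) (i + 1) =
        shortStrand F n (i + 1) * shortStrand F (n + 1) (i + 2) *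
          (crossing F (n + 1) i * crossing F (n + 1) (i + 1)) := by
      have far := shortStrand_mul_crossing_of_gt (F := F) h1 (Nat.lt_succ_self (i + 1))
        (show i + 2 ≤ n + 1 by omega)
      rw [Nat.add_sub_cancel] at far
      rw [shortStrand_of_lt hi, shortStrand_of_lt (show i + 1 < n + 1 by omega), mul_assoc,
        ← mul_assoc (crossing F n i), ← far]
      simp only [mul_assoc]
    calc shortStrand F n i * shortStrand F (n + 1) i
        = shortStrand F n i * shortStrand F (n + 1) (i + 1) * crossing F (n + 1) i := by
          rw [shortStrand_of_lt (show i < n + 1 by omega), mul_assoc]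
      _ = shortStrand F n (i + 1) * shortStrand F (n + 1) (i + 2) *
            (crossing F (n + 1) i * crossing F (n + 1) (i + 1) * crossing F (n + 1) i) := by
          rw [key, mul_assoc]
      _ = shortStrand F n (i + 1) * (shortStrand F (n + 1) (i + 2) * crossing F (n + 1) (i + 1)) *
            (crossing F (n + 1) i * crossing F (n + 1) (i + 1)) := by
          rw [crossing_braid h1 (by omega)]
          simp only [mul_assoc]
      _ = shortStrand F n i * shortStrand F (n + 1) (i + 1) := by
          rw [← shortStrand_of_lt (show i + 1 < n + 1 by omega), ih (by omega), key]

lemma shortStrand_mul_shortStrand {n i j : ℕ} (hj : 1 ≤ j) (h : j ≤ i) (hi : i ≤ n) :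
    shortStrand F n i * shortStrand F (n + 1) j =
      shortStrand F n j * shortStrand F (n + 1) (i + 1) := by
  induction h using Nat.decreasingInduction with
  | self => exact shortStrand_mul_shortStrand_same hj hi
  | of_succ j hji ih =>
    rw [shortStrand_of_lt (show j < n + 1 by omega), ← mul_assoc, ih (by omega), mul_assoc,
      shortStrand_mul_crossing_of_gt hj (by omega) (by omega), ← mul_assoc, Nat.add_sub_cancel,
      ← shortStrand_of_lt (by omega)]

variable (F)

/-- The homomorphism `B' → B` with `1(n) ↦ 1(n)`, `s_i(n) ↦ s_i(n)` and `w(n) ↦ v_n(n)`. -/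
noncomputable def fromSmaller : BAlg' F →ₐ[F] BAlg F :=
  RingQuot.liftAlgHom F ⟨FreeAlgebra.lift F fun
    | .one n => bE F n
    | .s n i h1 h2 => bS F n i h1 h2
    | .w n h => bV F n n h le_rfl, by
      intro x y h
      cases h <;> simp only [map_mul, map_zero, FreeAlgebra.lift_ι_apply, bE, bS, bV]
      case symmetric n h =>
        have e₁ := RingQuot.mkAlgHom_rel F (BRel.slide (K := F) (n + 1) n h le_rfl)
        have e₂ := RingQuot.mkAlgHom_rel F (BRel.v_v (K := F) n n n h le_rfl h (by omega) le_rfl)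
        simp only [map_mul] at e₁ e₂
        rw [← e₂, mul_assoc, e₁, e₂]
      all_goals simp only [← map_mul]
      case idem_self n => exact RingQuot.mkAlgHom_rel F (.idem_self n)
      case idem_orth n m h =>
        rw [← map_zero (RingQuot.mkAlgHom F (BRel F))]
        exact RingQuot.mkAlgHom_rel F (.idem_orth n m h)
      case one_s n i h1 h2 => exact RingQuot.mkAlgHom_rel F (.one_s n i h1 h2)
      case s_one n i h1 h2 => exact RingQuot.mkAlgHom_rel F (.s_one n i h1 h2)
      case s_sq n i h1 h2 => exact RingQuot.mkAlgHom_rel F (.s_sq n i h1 h2)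
      case braid n i h1 h2 => exact RingQuot.mkAlgHom_rel F (.braid n i h1 h2)
      case s_comm n i j hi1 hi2 hj1 hj2 h =>
        exact RingQuot.mkAlgHom_rel F (.s_comm n i j hi1 hi2 hj1 hj2 h)
      case one_w n h => exact RingQuot.mkAlgHom_rel F (.one_v n n h le_rfl)
      case w_one n h => exact RingQuot.mkAlgHom_rel F (.v_one n n h le_rfl)
      case w_s n i h h1 h2 =>
        exact RingQuot.mkAlgHom_rel F (.v_s_far n n i h le_rfl h1 (by omega) h2)⟩

/-- The homomorphism `B → B'` with `1(n) ↦ 1(n)`, `s_i(n) ↦ s_i(n)` and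
`v_i(n) ↦ w(n) s_{n-1}(n) ⋯ s_i(n)`. -/
noncomputable def toSmaller : BAlg F →ₐ[F] BAlg' F :=
  RingQuot.liftAlgHom F ⟨FreeAlgebra.lift F fun
    | .one n => bE' F n
    | .s n i _ _ => crossing F n i
    | .v n i _ _ => shortStrand F n i, by
      intro x y h
      cases h <;> simp only [map_mul, map_zero, FreeAlgebra.lift_ι_apply]
      case idem_self n =>
        simp only [bE', ← map_mul]
        exact RingQuot.mkAlgHom_rel F (.idem_self n)
      case idem_orth n m h =>
        rw [← map_zero (RingQuot.mkAlgHom F (BRel' F))]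
        simp only [bE', ← map_mul]
        exact RingQuot.mkAlgHom_rel F (.idem_orth n m h)
      case one_s n i h1 h2 =>
        simp only [crossing_eq h1 h2, bS', bE', ← map_mul]
        exact RingQuot.mkAlgHom_rel F (.one_s n i h1 h2)
      case s_one n i h1 h2 => exact crossing_mul_idem h1 h2
      case one_v n i h1 h2 => exact idem_mul_shortStrand h1 h2
      case v_one n i h1 h2 => exact shortStrand_mul_idem h1 h2
      case s_sq n i h1 h2 => exact crossing_sq h1 h2
      case braid n i h1 h2 => exact crossing_braid h1 h2
      case s_comm n i j hi1 hi2 hj1 hj2 h => exact crossing_comm hi1 hj2 h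
      case v_s_far n i j hi1 hi2 hj1 hj2 h => exact shortStrand_mul_crossing_of_gt hj1 h hi2
      case v_s_near n i j hi1 hi2 hj1 hj2 h => exact shortStrand_mul_crossing_of_lt hi1 h hj2
      case v_v n i j hi1 hi2 hj1 hj2 h => exact shortStrand_mul_shortStrand hj1 h hi2
      case slide n i h1 h2 => exact shortStrand_mul_crossing_self h1 h2⟩

variable {F}

lemma fromSmaller_bE' (n : ℕ) : fromSmaller F (bE' F n) = bE F n := by
  simp [fromSmaller, bE']

lemma fromSmaller_bS' (n i : ℕ) (h1 : 1 ≤ i) (h2 : i + 1 ≤ n) :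
    fromSmaller F (bS' F n i h1 h2) = bS F n i h1 h2 := by
  simp [fromSmaller, bS']

lemma fromSmaller_bW (n : ℕ) (h : 1 ≤ n) :
    fromSmaller F (bW F n h) = bV F n n h le_rfl := by
  simp [fromSmaller, bW]

lemma toSmaller_bE (n : ℕ) : toSmaller F (bE F n) = bE' F n := by
  simp [toSmaller, bE]

lemma toSmaller_bS (n i : ℕ) (h1 : 1 ≤ i) (h2 : i + 1 ≤ n) :
    toSmaller F (bS F n i h1 h2) = bS' F n i h1 h2 := by
  simp [toSmaller, bS, crossing_eq h1 h2]

lemma toSmaller_bV (n i : ℕ) (h1 : 1 ≤ i) (h2 : i ≤ n) :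
    toSmaller F (bV F n i h1 h2) = shortStrand F n i := by
  simp [toSmaller, bV]

lemma bV_succ_mul_bS (n i : ℕ) (h1 : 1 ≤ i) (h2 : i + 1 ≤ n) :
    bV F n (i + 1) (by omega) h2 * bS F n i h1 h2 = bV F n i h1 (by omega) := by
  have e₁ := RingQuot.mkAlgHom_rel F (BRel.slide (K := F) n i h1 h2)
  have e₂ := RingQuot.mkAlgHom_rel F (BRel.s_sq (K := F) n i h1 h2)
  have e₃ := RingQuot.mkAlgHom_rel F (BRel.v_one (K := F) n i h1 (by omega))
  simp only [map_mul] at e₁ e₂ e₃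
  rw [bV, bS, bV, ← e₁, mul_assoc, e₂, e₃]

lemma fromSmaller_shortStrand (n i : ℕ) (h1 : 1 ≤ i) (h2 : i ≤ n) :
    fromSmaller F (shortStrand F n i) = bV F n i h1 h2 := by
  induction h2 using Nat.decreasingInduction with
  | self => rw [shortStrand_self, lastStrand_eq h1, fromSmaller_bW]
  | of_succ i hi ih =>
    rw [shortStrand_of_lt hi, map_mul, ih (by omega), crossing_eq h1 hi, fromSmaller_bS',
      bV_succ_mul_bS]

lemma toSmaller_comp_fromSmaller :
    (toSmaller F).comp (fromSmaller F) = AlgHom.id F (BAlg' F) := by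
  refine RingQuot.ringQuot_ext' _ _ _ (FreeAlgebra.hom_ext (funext fun x => ?_))
  cases x with
  | one n => exact (congrArg (toSmaller F) (fromSmaller_bE' n)).trans (toSmaller_bE n)
  | s n i h1 h2 =>
    exact (congrArg (toSmaller F) (fromSmaller_bS' n i h1 h2)).trans (toSmaller_bS n i h1 h2)
  | w n h =>
    exact (congrArg (toSmaller F) (fromSmaller_bW n h)).trans
      ((toSmaller_bV n n h le_rfl).trans ((shortStrand_self n).trans (lastStrand_eq h)))

lemma fromSmaller_comp_toSmaller :
    (fromSmaller F).comp (toSmaller F) = AlgHom.id F (BAlg F) := by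
  refine RingQuot.ringQuot_ext' _ _ _ (FreeAlgebra.hom_ext (funext fun x => ?_))
  cases x with
  | one n => exact (congrArg (fromSmaller F) (toSmaller_bE n)).trans (fromSmaller_bE' n)
  | s n i h1 h2 =>
    exact (congrArg (fromSmaller F) (toSmaller_bS n i h1 h2)).trans (fromSmaller_bS' n i h1 h2)
  | v n i h1 h2 =>
    exact (congrArg (fromSmaller F) (toSmaller_bV n i h1 h2)).trans
      (fromSmaller_shortStrand n i h1 h2)

end SmallerPresentation

/-- Lemma 2.2: the `K`-algebra homomorphism `B' → B` determined by
`1(n) ↦ 1(n)`, `s_i(n) ↦ s_i(n)` and `w(n) ↦ v_n(n)` is well defined and is an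
isomorphism of `K`-algebras. -/
theorem smaller_presentation_iso (K : Type) [Field K] [CharZero K] :
    ∃ φ : BAlg' K →ₐ[K] BAlg K,
      (∀ n : ℕ, φ (bE' K n) = bE K n) ∧
      (∀ (n i : ℕ) (h1 : 1 ≤ i) (h2 : i + 1 ≤ n), φ (bS' K n i h1 h2) = bS K n i h1 h2) ∧
      (∀ (n : ℕ) (h : 1 ≤ n), φ (bW K n h) = bV K n n h le_rfl) ∧
      Function.Bijective φ := by
  refine ⟨fromSmaller K, fromSmaller_bE', fromSmaller_bS', fromSmaller_bW,
    Function.bijective_iff_has_inverse.2 ⟨toSmaller K, fun x => ?_, fun x => ?_⟩⟩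
  · exact DFunLike.congr_fun toSmaller_comp_fromSmaller x
  · exact DFunLike.congr_fun fromSmaller_comp_toSmaller x
end

section
/- For every n ≥ 0, the K-algebra homomorphism from the group algebra K[S_n] of the symmetric group S_n to the corner algebra B(n,n) = 1(n)·B·1(n) (whose unit is 1(n)), sending each simple transposition (i,i+1) to s_i(n), is an isomorphism of K-algebras. -/
variable (K : Type) [Field K] [CharZero K]

section CoxeterPresentation

variable {P : Type*} [Monoid P]

/-- The descending product `T (j + l - 1) * ⋯ * T (j + 1) * T j`. -/
def descProd (T : ℕ → P) : ℕ → ℕ → P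
  | _, 0 => 1
  | j, l + 1 => descProd T (j + 1) l * T j

/-- The Coxeter relations of the symmetric group on `n` letters for `T 0, …, T (n - 2)`. -/
structure SymmRelations (n : ℕ) (T : ℕ → P) : Prop where
  sq : ∀ i, i + 1 < n → T i * T i = 1
  braid : ∀ i, i + 2 < n → T i * T (i + 1) * T i = T (i + 1) * T i * T (i + 1)
  comm : ∀ i j, i + 1 < j → j + 1 < n → T i * T j = T j * T i

namespace SymmRelations

variable {n : ℕ} {T : ℕ → P}

theorem descProd_mul_of_lt (hT : SymmRelations n T) {i : ℕ} :
    ∀ {l j : ℕ}, i + 1 < j → j + l ≤ n - 1 → descProd T j l * T i = T i * descProd T j l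
  | 0, _, _, _ => by simp [descProd]
  | l + 1, j, hij, hjl => by
    rw [descProd, mul_assoc, ← hT.comm i j hij (by omega), ← mul_assoc,
      descProd_mul_of_lt hT (by omega) (by omega), mul_assoc]

theorem descProd_mul_of_gt (hT : SymmRelations n T) {i : ℕ} :
    ∀ {l j : ℕ}, j ≤ i → i + 1 < j + l → j + l ≤ n - 1 →
      descProd T j l * T (i + 1) = T i * descProd T j l
  | 0, _, _, _, _ => by omega
  | l + 1, j, hji, hil, hjl => by
    rcases hji.lt_or_eq with h | rfl
    · rw [descProd, mul_assoc, hT.comm j (i + 1) (by omega) (by omega), ← mul_assoc,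
        descProd_mul_of_gt hT (by omega) (by omega) (by omega), mul_assoc]
    · obtain ⟨l, rfl⟩ : ∃ l', l = l' + 1 := ⟨l - 1, by omega⟩
      rw [descProd, descProd, mul_assoc, mul_assoc, ← mul_assoc (T (j + 1)),
        ← hT.braid j (by omega), ← mul_assoc, ← mul_assoc,
        descProd_mul_of_lt hT (by omega) (by omega)]
      simp only [mul_assoc]

/-- Normal form: an element of the submonoid generated by `T 0, …, T k` is an element of the
submonoid generated by `T 0, …, T (k - 1)` times a descending product starting at `T k`. -/
theorem exists_eq_mul_descProd (hT : SymmRelations n T) {k : ℕ} (hk : k + 1 < n) {x : P}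
    (hx : x ∈ Submonoid.closure (T '' Set.Iio (k + 1))) :
    ∃ u ∈ Submonoid.closure (T '' Set.Iio k), ∃ j l, j + l = k + 1 ∧ x = u * descProd T j l := by
  induction hx using Submonoid.closure_induction_right with
  | one => exact ⟨1, one_mem _, k + 1, 0, rfl, by simp [descProd]⟩
  | mul_right x _ y hy ih =>
    obtain ⟨i, hi, rfl⟩ := hy
    obtain ⟨u, hu, j, l, hjl, rfl⟩ := ih
    have hi : i < k + 1 := hi
    have mem {a : ℕ} (ha : a < k) : u * T a ∈ Submonoid.closure (T '' Set.Iio k) :=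
      mul_mem hu (Submonoid.subset_closure ⟨a, ha, rfl⟩)
    rcases lt_trichotomy i j with h | rfl | h
    · rcases Nat.lt_or_ge (i + 1) j with h' | h'
      · refine ⟨_, mem (by omega : i < k), j, l, hjl, ?_⟩
        rw [mul_assoc, descProd_mul_of_lt hT h' (by omega), mul_assoc]
      · obtain rfl : j = i + 1 := by omega
        exact ⟨u, hu, i, l + 1, by omega, by rw [descProd, mul_assoc]⟩
    · obtain ⟨l, rfl⟩ : ∃ l', l = l' + 1 := ⟨l - 1, by omega⟩
      refine ⟨u, hu, i + 1, l, by omega, ?_⟩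
      rw [descProd, mul_assoc, mul_assoc, hT.sq i (by omega), mul_one]
    · obtain ⟨i, rfl⟩ : ∃ i', i = i' + 1 := ⟨i - 1, by omega⟩
      refine ⟨_, mem (by omega : i < k), j, l, hjl, ?_⟩
      rw [mul_assoc, descProd_mul_of_gt hT (by omega) (by omega) (by omega), mul_assoc]

variable {π : P →* Equiv.Perm ℕ}

theorem map_descProd_apply (hπ : ∀ i, i + 1 < n → π (T i) = Equiv.swap i (i + 1)) :
    ∀ {l j : ℕ}, j + l < n → π (descProd T j l) j = j + l
  | 0, _, _ => by simp [descProd]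
  | l + 1, j, h => by
    rw [descProd, map_mul, hπ j (by omega), Equiv.Perm.mul_apply, Equiv.swap_apply_left,
      map_descProd_apply hπ (by omega)]
    omega

theorem map_apply_of_mem_closure (hπ : ∀ i, i + 1 < n → π (T i) = Equiv.swap i (i + 1))
    {k : ℕ} (hk : k < n) {x : P} (hx : x ∈ Submonoid.closure (T '' Set.Iio k)) {a : ℕ}
    (ha : k < a) : π x a = a := by
  induction hx using Submonoid.closure_induction with
  | mem x hx =>
    obtain ⟨i, hi, rfl⟩ := hx
    have hi : i < k := hi
    rw [hπ i (by omega), Equiv.swap_apply_of_ne_of_ne (by omega) (by omega)]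
  | one => simp
  | mul x y _ _ hx hy => rw [map_mul, Equiv.Perm.mul_apply, hy, hx]

theorem injOn_closure (hT : SymmRelations n T)
    (hπ : ∀ i, i + 1 < n → π (T i) = Equiv.swap i (i + 1)) :
    ∀ k < n, Set.InjOn π (Submonoid.closure (T '' Set.Iio k))
  | 0, _ => by simp
  | k + 1, hk => by
    intro x hx y hy hxy
    obtain ⟨u, hu, j, l, hjl, rfl⟩ := exists_eq_mul_descProd hT hk hx
    obtain ⟨u', hu', j', l', hjl', rfl⟩ := exists_eq_mul_descProd hT hk hy
    have key {v : P} (hv : v ∈ Submonoid.closure (T '' Set.Iio k)) {a b : ℕ} (hab : a + b = k + 1) :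
        π (v * descProd T a b) a = k + 1 := by
      rw [map_mul, Equiv.Perm.mul_apply, map_descProd_apply hπ (by omega), hab,
        map_apply_of_mem_closure hπ (by omega) hv (by omega)]
    obtain rfl : j = j' := (π (u' * descProd T j' l')).injective <| by
      rw [key hu' hjl', ← hxy, key hu hjl]
    obtain rfl : l = l' := by omega
    rw [map_mul, map_mul, mul_left_inj] at hxy
    rw [injOn_closure hT hπ k (by omega) hu hu' hxy]

theorem swap_nat (n : ℕ) : SymmRelations n fun i ↦ Equiv.swap i (i + 1) where
  sq i _ := Equiv.swap_mul_self _ _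
  braid i _ := by
    ext a
    simp only [Equiv.Perm.mul_apply, Equiv.swap_apply_def]
    split_ifs <;> omega
  comm i j _ _ := by
    ext a
    simp only [Equiv.Perm.mul_apply, Equiv.swap_apply_def]
    split_ifs <;> omega

theorem extendDomain_swap (i j : Fin n) :
    (Equiv.swap i j).extendDomain Fin.equivSubtype = Equiv.swap (i : ℕ) (j : ℕ) := by
  ext a
  by_cases ha : a < n
  · have := Equiv.Perm.extendDomain_apply_image (Equiv.swap i j) Fin.equivSubtype ⟨a, ha⟩
    simp only [Fin.equivSubtype_apply] at this
    rw [this]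
    simp only [Equiv.swap_apply_def, Fin.ext_iff]
    split_ifs <;> rfl
  · rw [Equiv.Perm.extendDomain_apply_not_subtype (Equiv.swap i j) Fin.equivSubtype ha,
      Equiv.swap_apply_of_ne_of_ne (by omega) (by omega)]

theorem swap_fin_braid {i : ℕ} (h : i + 2 < n) :
    (Equiv.swap ⟨i, by omega⟩ ⟨i + 1, by omega⟩ * Equiv.swap ⟨i + 1, by omega⟩ ⟨i + 2, h⟩ *
        Equiv.swap ⟨i, by omega⟩ ⟨i + 1, by omega⟩ : Equiv.Perm (Fin n)) =
      Equiv.swap ⟨i + 1, by omega⟩ ⟨i + 2, h⟩ * Equiv.swap ⟨i, by omega⟩ ⟨i + 1, by omega⟩ *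
        Equiv.swap ⟨i + 1, by omega⟩ ⟨i + 2, h⟩ := by
  apply Equiv.Perm.extendDomainHom_injective Fin.equivSubtype
  simpa only [map_mul, Equiv.Perm.extendDomainHom_apply, extendDomain_swap] using
    (swap_nat n).braid i h

theorem swap_fin_comm {i j : ℕ} (hij : i + 1 < j) (hj : j + 1 < n) :
    (Equiv.swap ⟨i, by omega⟩ ⟨i + 1, by omega⟩ *
        Equiv.swap ⟨j, by omega⟩ ⟨j + 1, hj⟩ : Equiv.Perm (Fin n)) =
      Equiv.swap ⟨j, by omega⟩ ⟨j + 1, hj⟩ * Equiv.swap ⟨i, by omega⟩ ⟨i + 1, by omega⟩ := by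
  apply Equiv.Perm.extendDomainHom_injective Fin.equivSubtype
  simpa only [map_mul, Equiv.Perm.extendDomainHom_apply, extendDomain_swap] using
    (swap_nat n).comm i j hij hj

theorem mclosure_swap_succ (n : ℕ) :
    Submonoid.closure {σ : Equiv.Perm (Fin n) |
      ∃ (i : ℕ) (h : i + 1 < n), σ = Equiv.swap ⟨i, by omega⟩ ⟨i + 1, h⟩} = ⊤ := by
  cases n with
  | zero => exact Subsingleton.elim _ _
  | succ m =>
    rw [eq_top_iff, ← Equiv.Perm.mclosure_swap_castSucc_succ]
    refine Submonoid.closure_mono ?_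
    rintro _ ⟨i, rfl⟩
    exact ⟨i, by omega, rfl⟩

/-- Elements of a monoid satisfying the Coxeter relations of the symmetric group define a
homomorphism from the symmetric group. -/
theorem exists_monoidHom {M : Type*} [Monoid M] {n : ℕ} {t : ℕ → M} (ht : SymmRelations n t) :
    ∃ F : Equiv.Perm (Fin n) →* M, ∀ (i : ℕ) (h : i + 1 < n),
      F (Equiv.swap ⟨i, by omega⟩ ⟨i + 1, h⟩) = t i := by
  cases n with
  | zero => exact ⟨1, fun i h ↦ by omega⟩
  | succ m =>
  let T : ℕ → M × Equiv.Perm ℕ := fun i ↦ (t i, Equiv.swap i (i + 1))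
  have hw := swap_nat (m + 1)
  have hT : SymmRelations (m + 1) T :=
    ⟨fun i h ↦ Prod.ext (ht.sq i h) (hw.sq i h),
      fun i h ↦ Prod.ext (ht.braid i h) (hw.braid i h),
      fun i j h h' ↦ Prod.ext (ht.comm i j h h') (hw.comm i j h h')⟩
  let π : M × Equiv.Perm ℕ →* Equiv.Perm ℕ := MonoidHom.snd _ _
  let N := Submonoid.closure (T '' Set.Iio m)
  have hinj : Set.InjOn π N := injOn_closure hT (fun _ _ ↦ rfl) m (by omega)
  let ext := Equiv.Perm.extendDomainHom (Fin.equivSubtype (n := m + 1))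
  have hsurj (σ : Equiv.Perm (Fin (m + 1))) : ∃ x ∈ N, π x = ext σ := by
    have hσ : σ ∈ (⊤ : Submonoid _) := trivial
    rw [← mclosure_swap_succ] at hσ
    induction hσ using Submonoid.closure_induction with
    | mem σ hσ =>
      obtain ⟨i, h, rfl⟩ := hσ
      exact ⟨T i, Submonoid.subset_closure ⟨i, by simpa using h, rfl⟩,
        (extendDomain_swap ⟨i, by omega⟩ ⟨i + 1, h⟩).symm⟩
    | one => exact ⟨1, one_mem _, by rw [map_one, map_one]⟩
    | mul a b _ _ ha hb =>
      obtain ⟨x, hx, hxa⟩ := ha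
      obtain ⟨y, hy, hyb⟩ := hb
      exact ⟨x * y, mul_mem hx hy, by rw [map_mul, map_mul, hxa, hyb]⟩
  choose f hfN hf using hsurj
  let F : Equiv.Perm (Fin (m + 1)) →* M × Equiv.Perm ℕ :=
    { toFun := f
      map_one' := hinj (hfN 1) (one_mem _) (by rw [hf, map_one, map_one])
      map_mul' := fun a b ↦ hinj (hfN _) (mul_mem (hfN a) (hfN b))
        (by rw [hf, map_mul, map_mul, hf, hf]) }
  refine ⟨(MonoidHom.fst _ _).comp F, fun i h ↦ ?_⟩
  have : f (Equiv.swap ⟨i, by omega⟩ ⟨i + 1, h⟩) = T i := by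
    refine hinj (hfN _) (Submonoid.subset_closure ⟨i, by simpa using h, rfl⟩) ?_
    rw [hf]
    exact extendDomain_swap _ _
  exact congrArg Prod.fst this

end SymmRelations

end CoxeterPresentation

section Relations

set_option linter.unusedSectionVars false

theorem bE_mul_bE_self (n : ℕ) : bE K n * bE K n = bE K n := by
  simpa [bE] using RingQuot.mkAlgHom_rel K (BRel.idem_self (K := K) n)

theorem bE_mul_bE_of_ne {n m : ℕ} (h : n ≠ m) : bE K n * bE K m = 0 := by
  simpa [bE] using RingQuot.mkAlgHom_rel K (BRel.idem_orth (K := K) n m h)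

variable {n i : ℕ}

theorem bE_mul_bS (h1 : 1 ≤ i) (h2 : i + 1 ≤ n) : bE K n * bS K n i h1 h2 = bS K n i h1 h2 := by
  simpa [bE, bS] using RingQuot.mkAlgHom_rel K (BRel.one_s (K := K) n i h1 h2)

theorem bS_mul_bE (h1 : 1 ≤ i) (h2 : i + 1 ≤ n) : bS K n i h1 h2 * bE K n = bS K n i h1 h2 := by
  simpa [bE, bS] using RingQuot.mkAlgHom_rel K (BRel.s_one (K := K) n i h1 h2)

theorem bE_mul_bV (h1 : 1 ≤ i) (h2 : i ≤ n) : bE K (n - 1) * bV K n i h1 h2 = bV K n i h1 h2 := by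
  simpa [bE, bV] using RingQuot.mkAlgHom_rel K (BRel.one_v (K := K) n i h1 h2)

theorem bV_mul_bE (h1 : 1 ≤ i) (h2 : i ≤ n) : bV K n i h1 h2 * bE K n = bV K n i h1 h2 := by
  simpa [bE, bV] using RingQuot.mkAlgHom_rel K (BRel.v_one (K := K) n i h1 h2)

theorem bS_mul_self (h1 : 1 ≤ i) (h2 : i + 1 ≤ n) :
    bS K n i h1 h2 * bS K n i h1 h2 = bE K n := by
  simpa [bE, bS] using RingQuot.mkAlgHom_rel K (BRel.s_sq (K := K) n i h1 h2)

theorem bS_braid (h1 : 1 ≤ i) (h2 : i + 2 ≤ n) :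
    bS K n i h1 (by omega) * bS K n (i + 1) (by omega) h2 * bS K n i h1 (by omega) =
      bS K n (i + 1) (by omega) h2 * bS K n i h1 (by omega) * bS K n (i + 1) (by omega) h2 := by
  simpa [bS] using RingQuot.mkAlgHom_rel K (BRel.braid (K := K) n i h1 h2)

theorem bS_comm {j : ℕ} (hi1 : 1 ≤ i) (hi2 : i + 1 ≤ n) (hj1 : 1 ≤ j) (hj2 : j + 1 ≤ n)
    (h : i + 1 < j) :
    bS K n i hi1 hi2 * bS K n j hj1 hj2 = bS K n j hj1 hj2 * bS K n i hi1 hi2 := by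
  simpa [bS] using RingQuot.mkAlgHom_rel K (BRel.s_comm (K := K) n i j hi1 hi2 hj1 hj2 h)

theorem bE_mul_bS_of_ne {m : ℕ} (hm : m ≠ n) (h1 : 1 ≤ i) (h2 : i + 1 ≤ n) :
    bE K m * bS K n i h1 h2 = 0 := by
  rw [← bE_mul_bS, ← mul_assoc, bE_mul_bE_of_ne K hm, zero_mul]

theorem bE_mul_bV_of_ne {m : ℕ} (hm : m + 1 ≠ n) (h1 : 1 ≤ i) (h2 : i ≤ n) :
    bE K m * bV K n i h1 h2 = 0 := by
  rw [← bE_mul_bV, ← mul_assoc, bE_mul_bE_of_ne K (by omega), zero_mul]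

/-- In an algebra, if `e` acts as a unit on `a` and `b`, then `a + (1 - e)` and `b + (1 - e)`
multiply as `a` and `b` do in the corner. -/
theorem add_one_sub_mul_add_one_sub {R : Type*} [Ring R] {e a b : R} (he : e * e = e)
    (ha : a * e = a) (hb : e * b = b) :
    (a + (1 - e)) * (b + (1 - e)) = a * b + (1 - e) := by
  have : (a + (1 - e)) * (b + (1 - e)) =
      a * b + (a - a * e) + (b - e * b) + (1 - e - (e - e * e)) := by noncomm_ring
  rw [this, he, ha, hb]
  simp

/-- The crossing `s_{i+1}(n)`, completed by `1 - 1(n)` to a unit of `B`. -/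
def crossingUnit (n i : ℕ) : BAlg K :=
  if h : i + 1 < n then bS K n (i + 1) (by omega) h + (1 - bE K n) else 1

theorem crossingUnit_of_lt {n i : ℕ} (h : i + 1 < n) :
    crossingUnit K n i = bS K n (i + 1) (by omega) h + (1 - bE K n) := dif_pos h

theorem symmRelations_crossingUnit (n : ℕ) : SymmRelations n (crossingUnit K n) where
  sq i h := by
    rw [crossingUnit_of_lt K h, add_one_sub_mul_add_one_sub (bE_mul_bE_self K n)
      (bS_mul_bE K _ _) (bE_mul_bS K _ _), bS_mul_self, add_sub_cancel]
  braid i h := by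
    have he := bE_mul_bE_self K n
    rw [crossingUnit_of_lt K (by omega : i + 1 < n),
      crossingUnit_of_lt K (by omega : i + 1 + 1 < n),
      add_one_sub_mul_add_one_sub he (bS_mul_bE K _ _) (bE_mul_bS K _ _),
      add_one_sub_mul_add_one_sub he (by rw [mul_assoc, bS_mul_bE]) (bE_mul_bS K _ _),
      add_one_sub_mul_add_one_sub he (bS_mul_bE K _ _) (bE_mul_bS K _ _),
      add_one_sub_mul_add_one_sub he (by rw [mul_assoc, bS_mul_bE]) (bE_mul_bS K _ _),
      bS_braid]
  comm i j hij hj := by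
    have he := bE_mul_bE_self K n
    rw [crossingUnit_of_lt K (by omega : i + 1 < n), crossingUnit_of_lt K hj,
      add_one_sub_mul_add_one_sub he (bS_mul_bE K _ _) (bE_mul_bS K _ _),
      add_one_sub_mul_add_one_sub he (bS_mul_bE K _ _) (bE_mul_bS K _ _),
      bS_comm K _ _ _ _ (by omega)]

/-- A subspace containing `1(n)` and stable under left multiplication by the crossings `s_i(n)`
contains the corner `1(n)·B·1(n)`. -/
theorem bE_mul_mul_bE_mem {n : ℕ} {R : Submodule K (BAlg K)} (he : bE K n ∈ R)
    (hs : ∀ i h1 h2, ∀ x ∈ R, bS K n i h1 h2 * x ∈ R) (b : BAlg K) :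
    bE K n * (b * bE K n) ∈ R := by
  suffices ∀ a : FreeAlgebra K BGen, ∀ x : BAlg K,
      (bE K n * x ∈ R ∧ ∀ m, n < m → bE K m * x = 0) →
      bE K n * (RingQuot.mkAlgHom K (BRel K) a * x) ∈ R ∧
        ∀ m, n < m → bE K m * (RingQuot.mkAlgHom K (BRel K) a * x) = 0 by
    obtain ⟨a, rfl⟩ := RingQuot.mkAlgHom_surjective K (BRel K) b
    exact (this a _ ⟨by rwa [bE_mul_bE_self], fun m hm ↦ bE_mul_bE_of_ne K hm.ne'⟩).1
  intro a
  induction a using FreeAlgebra.induction with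
  | grade0 r =>
    rintro x ⟨hx, hx'⟩
    simp only [AlgHom.commutes, ← Algebra.smul_def, mul_smul_comm]
    exact ⟨R.smul_mem _ hx, fun m hm ↦ by rw [hx' m hm, smul_zero]⟩
  | add a b ha hb =>
    intro x hx
    simp only [map_add, add_mul, mul_add]
    exact ⟨R.add_mem (ha x hx).1 (hb x hx).1,
      fun m hm ↦ by rw [(ha x hx).2 m hm, (hb x hx).2 m hm, add_zero]⟩
  | mul a b ha hb =>
    intro x hx
    simp only [map_mul, mul_assoc]
    exact ha _ (hb x hx)
  | grade1 g =>
    rintro x ⟨hx, hx'⟩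
    cases g with
    | one k =>
      have key (m : ℕ) : bE K m * (bE K k * x) = if m = k then bE K m * x else 0 := by
        rw [← mul_assoc]
        split_ifs with h
        · rw [h, bE_mul_bE_self]
        · rw [bE_mul_bE_of_ne K h, zero_mul]
      change bE K n * (bE K k * x) ∈ R ∧ ∀ m, n < m → bE K m * (bE K k * x) = 0
      refine ⟨?_, fun m hm ↦ by rw [key, hx' m hm, ite_self]⟩
      rw [key]
      split_ifs
      exacts [hx, R.zero_mem]
    | s k i h1 h2 =>
      change bE K n * (bS K k i h1 h2 * x) ∈ R ∧ ∀ m, n < m → bE K m * (bS K k i h1 h2 * x) = 0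
      constructor
      · rw [← mul_assoc]
        by_cases h : n = k
        · subst h
          rw [bE_mul_bS, ← bS_mul_bE, mul_assoc]
          exact hs _ _ _ _ hx
        · rw [bE_mul_bS_of_ne K h, zero_mul]
          exact R.zero_mem
      · intro m hm
        rw [← mul_assoc]
        by_cases h : m = k
        · subst h
          rw [bE_mul_bS, ← bS_mul_bE, mul_assoc, hx' m hm, mul_zero]
        · rw [bE_mul_bS_of_ne K h, zero_mul]
    | v k i h1 h2 =>
      have key (m : ℕ) (hm : n ≤ m) : bE K m * (bV K k i h1 h2 * x) = 0 := by
        rw [← mul_assoc]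
        by_cases h : m + 1 = k
        · subst h
          rw [← bV_mul_bE, mul_assoc, mul_assoc, hx' _ (by omega), mul_zero, mul_zero]
        · rw [bE_mul_bV_of_ne K h, zero_mul]
      change bE K n * (bV K k i h1 h2 * x) ∈ R ∧ ∀ m, n < m → bE K m * (bV K k i h1 h2 * x) = 0
      exact ⟨key n le_rfl ▸ R.zero_mem, fun m hm ↦ key m hm.le⟩

end Relations

section Retraction

set_option linter.unusedSectionVars false

/-- The images of the generators of `B` in `K[S_n]`: all strands, and everything living on
`m ≠ n` strands, are killed. -/
noncomputable def genToGroupAlgebra (n : ℕ) : BGen → MonoidAlgebra K (Equiv.Perm (Fin n))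
  | .one m => if m = n then 1 else 0
  | .s m i _ h2 =>
    if h : m = n then
      MonoidAlgebra.of K _ (Equiv.swap (⟨i - 1, by omega⟩ : Fin n) ⟨i, by omega⟩)
    else 0
  | .v _ _ _ _ => 0

theorem lift_genToGroupAlgebra_eq (n : ℕ) ⦃x y : FreeAlgebra K BGen⦄ (h : BRel K x y) :
    FreeAlgebra.lift K (genToGroupAlgebra K n) x = FreeAlgebra.lift K (genToGroupAlgebra K n) y := by
  cases h with
  | s_sq m i h1 h2 =>
    by_cases hm : m = n
    · simp [genToGroupAlgebra, hm, MonoidAlgebra.single_mul_single, MonoidAlgebra.one_def]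
    · simp [genToGroupAlgebra, hm]
  | braid m i h1 h2 =>
    by_cases hm : m = n
    · subst hm
      simp only [genToGroupAlgebra, map_mul, FreeAlgebra.lift_ι_apply, dite_true]
      simp only [← map_mul]
      obtain ⟨i, rfl⟩ : ∃ i', i = i' + 1 := ⟨i - 1, by omega⟩
      exact congrArg _ (SymmRelations.swap_fin_braid (by omega))
    · simp [genToGroupAlgebra, hm]
  | s_comm m i j hi1 hi2 hj1 hj2 h =>
    by_cases hm : m = n
    · subst hm
      simp only [genToGroupAlgebra, map_mul, FreeAlgebra.lift_ι_apply, dite_true]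
      simp only [← map_mul]
      obtain ⟨i, rfl⟩ : ∃ i', i = i' + 1 := ⟨i - 1, by omega⟩
      obtain ⟨j, rfl⟩ : ∃ j', j = j' + 1 := ⟨j - 1, by omega⟩
      exact congrArg _ (SymmRelations.swap_fin_comm (by omega) hj2)
    · simp [genToGroupAlgebra, hm]
  | idem_orth m k h =>
    simp only [genToGroupAlgebra, map_mul, FreeAlgebra.lift_ι_apply, map_zero]
    split_ifs <;> simp_all
  | one_s m i h1 h2 => by_cases hm : m = n <;> simp [genToGroupAlgebra, hm]
  | s_one m i h1 h2 => by_cases hm : m = n <;> simp [genToGroupAlgebra, hm]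
  | _ => simp [genToGroupAlgebra]

/-- The algebra homomorphism `B → K[S_n]` killing all strands and all `1(m)` with `m ≠ n`. -/
noncomputable def toGroupAlgebra (n : ℕ) : BAlg K →ₐ[K] MonoidAlgebra K (Equiv.Perm (Fin n)) :=
  RingQuot.liftAlgHom K ⟨FreeAlgebra.lift K (genToGroupAlgebra K n), lift_genToGroupAlgebra_eq K n⟩

theorem toGroupAlgebra_bE (n : ℕ) : toGroupAlgebra K n (bE K n) = 1 := by
  simp [toGroupAlgebra, bE, genToGroupAlgebra]

theorem toGroupAlgebra_bS {n i : ℕ} (h : i + 1 < n) :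
    toGroupAlgebra K n (bS K n (i + 1) i.succ_pos h) =
      MonoidAlgebra.of K _ (Equiv.swap ⟨i, i.lt_succ_self.trans h⟩ ⟨i + 1, h⟩) := by
  simp [toGroupAlgebra, bS, genToGroupAlgebra]

end Retraction

/-- The corner algebra `B(n,n) = 1(n)·B·1(n)` (whose unit is `1(n)`) is
isomorphic to the group algebra `K[S_n]` via the map sending each simple
transposition `(i,i+1)` to `s_i(n)`: formally, there is a `K`-linear map
`K[S_n] → B` which is injective, has image `B(n,n)`, is multiplicative, sends
`1` to `1(n)`, and sends each simple transposition to the corresponding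
crossing generator. -/
theorem group_algebra_iso_corner (K : Type) [Field K] [CharZero K] (n : ℕ) :
    ∃ φ : MonoidAlgebra K (Equiv.Perm (Fin n)) →ₗ[K] BAlg K,
      Function.Injective φ ∧
      LinearMap.range φ = Bspace K n n ∧
      (∀ x y : MonoidAlgebra K (Equiv.Perm (Fin n)), φ (x * y) = φ x * φ y) ∧
      φ 1 = bE K n ∧
      (∀ (i : ℕ) (h1 : 1 ≤ i) (h2 : i + 1 ≤ n),
        φ (MonoidAlgebra.of K (Equiv.Perm (Fin n))
            (Equiv.swap (⟨i - 1, by omega⟩ : Fin n) (⟨i, by omega⟩ : Fin n))) =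
          bS K n i h1 h2) := by
  obtain ⟨F, hF⟩ := (symmRelations_crossingUnit K n).exists_monoidHom
  let Φ : MonoidAlgebra K (Equiv.Perm (Fin n)) →ₐ[K] BAlg K := MonoidAlgebra.lift K _ _ F
  have hEE := bE_mul_bE_self K n
  have hswap (i : ℕ) (h : i + 1 < n) :
      F (Equiv.swap ⟨i, by omega⟩ ⟨i + 1, h⟩) =
        bS K n (i + 1) (by omega) h + (1 - bE K n) :=
    (hF i h).trans (crossingUnit_of_lt K h)
  have hcomm (x : MonoidAlgebra K (Equiv.Perm (Fin n))) : Commute (bE K n) (Φ x) := by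
    have hcommF (σ : Equiv.Perm (Fin n)) : Commute (bE K n) (F σ) := by
      have hσ : σ ∈ (⊤ : Submonoid _) := trivial
      rw [← SymmRelations.mclosure_swap_succ] at hσ
      induction hσ using Submonoid.closure_induction with
      | mem σ hσ =>
        obtain ⟨i, h, rfl⟩ := hσ
        rw [hswap, Commute, SemiconjBy, mul_add, add_mul, bE_mul_bS, bS_mul_bE, mul_sub, sub_mul,
          one_mul, mul_one]
      | one => rw [map_one]; exact Commute.one_right _
      | mul a b _ _ ha hb => rw [map_mul]; exact ha.mul_right hb
    induction x using MonoidAlgebra.induction_on with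
    | of σ => simpa [Φ] using hcommF σ
    | add x y hx hy => rw [map_add]; exact hx.add_right hy
    | smul r x hx => rw [map_smul]; exact hx.smul_right r
  let φ : MonoidAlgebra K (Equiv.Perm (Fin n)) →ₗ[K] BAlg K :=
    (LinearMap.mulLeft K (bE K n)).comp Φ.toLinearMap
  have hφ (x) : φ x = bE K n * Φ x := rfl
  have hone : φ 1 = bE K n := by rw [hφ, map_one, mul_one]
  have hmul (x y) : φ (x * y) = φ x * φ y := by
    rw [hφ, hφ, hφ, map_mul, mul_assoc, ← mul_assoc (Φ x), ← (hcomm x).eq, mul_assoc (bE K n),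
      ← mul_assoc (bE K n) (bE K n), hEE]
  have hsimple (i : ℕ) (h1 : 1 ≤ i) (h2 : i + 1 ≤ n) :
      φ (MonoidAlgebra.of K (Equiv.Perm (Fin n))
        (Equiv.swap (⟨i - 1, by omega⟩ : Fin n) (⟨i, by omega⟩ : Fin n))) = bS K n i h1 h2 := by
    obtain ⟨i, rfl⟩ : ∃ i', i = i' + 1 := ⟨i - 1, by omega⟩
    have : Φ (MonoidAlgebra.of K _ (Equiv.swap ⟨i, by omega⟩ ⟨i + 1, h2⟩)) = _ :=
      (MonoidAlgebra.lift_of F _).trans (hswap i h2)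
    refine (congrArg (bE K n * ·) this).trans ?_
    simp [mul_add, mul_sub, bE_mul_bS, hEE]
  refine ⟨φ, ?_, ?_, hmul, hone, hsimple⟩
  · refine Function.LeftInverse.injective (g := toGroupAlgebra K n) fun x ↦ ?_
    have hid : (toGroupAlgebra K n).comp Φ = AlgHom.id K _ := by
      refine MonoidAlgebra.algHom_ext' ?_ (Subsingleton.elim _ _)
      refine MonoidHom.eq_of_eqOn_denseM (SymmRelations.mclosure_swap_succ n) ?_
      rintro _ ⟨i, h, rfl⟩
      change toGroupAlgebra K n (Φ (MonoidAlgebra.of K _ _)) = MonoidAlgebra.of K _ _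
      rw [MonoidAlgebra.lift_of, hswap, map_add, map_sub, map_one, toGroupAlgebra_bE, sub_self,
        add_zero, toGroupAlgebra_bS]
    rw [hφ, map_mul, toGroupAlgebra_bE, one_mul]
    exact DFunLike.congr_fun hid x
  · apply le_antisymm
    · rintro _ ⟨x, rfl⟩
      refine ⟨Φ x, ?_⟩
      change bE K n * (Φ x * bE K n) = bE K n * Φ x
      rw [← (hcomm x).eq, ← mul_assoc, hEE]
    · rintro _ ⟨b, rfl⟩
      refine bE_mul_mul_bE_mem K (R := LinearMap.range φ) ⟨1, hone⟩ ?_ b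
      rintro i h1 h2 _ ⟨y, rfl⟩
      exact ⟨_, (hmul _ y).trans (congrArg (· * φ y) (hsimple i h1 h2))⟩
end

section
/- There is a well-defined injective homomorphism of non-unital K-algebras ρ : B → B determined on generators by ρ(1(n)) = 1(n+1), ρ(s_i(n)) = s_i(n+1), and ρ(v_i(n)) = v_i(n+1); in particular ρ maps B(m,n) into B(m+1,n+1). -/
variable (K : Type) [Field K] [CharZero K]

set_option linter.unusedSectionVars false

namespace BAlg

/-! ### Generators and relations, with total indexing -/

/-- The crossing `s_i(n)`, with junk value `0` outside `1 ≤ i < n`. -/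
noncomputable def sT (n i : ℕ) : BAlg K :=
  if h : 1 ≤ i ∧ i + 1 ≤ n then bS K n i h.1 h.2 else 0

/-- The short strand `v_i(n)`, with junk value `0` outside `1 ≤ i ≤ n`. -/
noncomputable def vT (n i : ℕ) : BAlg K :=
  if h : 1 ≤ i ∧ i ≤ n then bV K n i h.1 h.2 else 0

variable {K}

lemma sT_eq {n i : ℕ} (h1 : 1 ≤ i) (h2 : i + 1 ≤ n) : sT K n i = bS K n i h1 h2 :=
  dif_pos ⟨h1, h2⟩

lemma vT_eq {n i : ℕ} (h1 : 1 ≤ i) (h2 : i ≤ n) : vT K n i = bV K n i h1 h2 :=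
  dif_pos ⟨h1, h2⟩

lemma mk_rel {a b : FreeAlgebra K BGen} (h : BRel K a b) :
    RingQuot.mkAlgHom K (BRel K) a = RingQuot.mkAlgHom K (BRel K) b :=
  RingQuot.mkAlgHom_rel K h

lemma e_mul_e (n : ℕ) : bE K n * bE K n = bE K n := by
  simpa [bE] using mk_rel (BRel.idem_self (K := K) n)

lemma e_mul_e_of_ne {n m : ℕ} (h : n ≠ m) : bE K n * bE K m = 0 := by
  simpa [bE] using mk_rel (BRel.idem_orth (K := K) n m h)

lemma e_mul_sT (n i : ℕ) : bE K n * sT K n i = sT K n i := by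
  unfold sT
  split_ifs with h
  · simpa [bE, bS] using mk_rel (BRel.one_s (K := K) n i h.1 h.2)
  · simp

lemma sT_mul_e (n i : ℕ) : sT K n i * bE K n = sT K n i := by
  unfold sT
  split_ifs with h
  · simpa [bE, bS] using mk_rel (BRel.s_one (K := K) n i h.1 h.2)
  · simp

lemma e_mul_vT (n i : ℕ) : bE K n * vT K (n + 1) i = vT K (n + 1) i := by
  unfold vT
  split_ifs with h
  · simpa [bE, bV] using mk_rel (BRel.one_v (K := K) (n + 1) i h.1 h.2)
  · simp

lemma vT_mul_e (n i : ℕ) : vT K n i * bE K n = vT K n i := by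
  unfold vT
  split_ifs with h
  · simpa [bE, bV] using mk_rel (BRel.v_one (K := K) n i h.1 h.2)
  · simp

lemma sT_sq {n i : ℕ} (h1 : 1 ≤ i) (h2 : i + 1 ≤ n) : sT K n i * sT K n i = bE K n := by
  rw [sT_eq h1 h2]
  simpa [bE, bS] using mk_rel (BRel.s_sq (K := K) n i h1 h2)

lemma sT_braid {n i : ℕ} (h1 : 1 ≤ i) (h2 : i + 2 ≤ n) :
    sT K n i * sT K n (i + 1) * sT K n i = sT K n (i + 1) * sT K n i * sT K n (i + 1) := by
  rw [sT_eq (i := i) h1 (by omega), sT_eq (i := i + 1) (by omega) h2]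
  simpa [bS] using mk_rel (BRel.braid (K := K) n i h1 h2)

lemma sT_comm {n i j : ℕ} (h1 : 1 ≤ i) (h2 : j + 1 ≤ n) (h : i + 1 < j) :
    sT K n i * sT K n j = sT K n j * sT K n i := by
  rw [sT_eq (i := i) h1 (by omega), sT_eq (i := j) (by omega) h2]
  simpa [bS] using mk_rel (BRel.s_comm (K := K) n i j h1 (by omega) (by omega) h2 h)

lemma vT_mul_sT_far {n i j : ℕ} (hi : i ≤ n + 1) (hj : 1 ≤ j) (h : j + 1 < i) :
    vT K (n + 1) i * sT K (n + 1) j = sT K n j * vT K (n + 1) i := by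
  rw [sT_eq (n := n + 1) hj (by omega), vT_eq (by omega) hi, sT_eq hj (by omega)]
  simpa [bS, bV] using
    mk_rel (BRel.v_s_far (K := K) (n + 1) i j (by omega) hi hj (by omega) h)

lemma vT_mul_sT_near {n i j : ℕ} (hi : 1 ≤ i) (hj : j + 1 ≤ n) (h : i ≤ j) :
    vT K (n + 1) i * sT K (n + 1) (j + 1) = sT K n j * vT K (n + 1) i := by
  rw [sT_eq (n := n + 1) (by omega) (by omega), vT_eq hi (by omega), sT_eq (by omega) hj]
  simpa [bS, bV] using
    mk_rel (BRel.v_s_near (K := K) (n + 1) i (j + 1) hi (by omega) (by omega) (by omega)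
      (by omega))

lemma vT_mul_vT {n i j : ℕ} (hj : 1 ≤ j) (hi : i ≤ n) (h : j ≤ i) :
    vT K n i * vT K (n + 1) j = vT K n j * vT K (n + 1) (i + 1) := by
  rw [vT_eq (n := n) (by omega) hi, vT_eq (n := n + 1) hj (by omega),
    vT_eq (n := n) hj (by omega), vT_eq (n := n + 1) (by omega) (by omega)]
  simpa [bV] using mk_rel (BRel.v_v (K := K) n i j (by omega) hi hj (by omega) h)

lemma vT_slide {n i : ℕ} (h1 : 1 ≤ i) (h2 : i + 1 ≤ n) :
    vT K n i * sT K n i = vT K n (i + 1) := by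
  rw [vT_eq h1 (by omega), sT_eq h1 h2, vT_eq (by omega) h2]
  simpa [bS, bV] using mk_rel (BRel.slide (K := K) n i h1 h2)

lemma vT_slide_symm {n i : ℕ} (h1 : 1 ≤ i) (h2 : i + 1 ≤ n) :
    vT K n (i + 1) * sT K n i = vT K n i := by
  rw [← vT_slide h1 h2, mul_assoc, sT_sq h1 h2, vT_mul_e]

lemma mul_eq_zero_of_ne {n m : ℕ} (h : n ≠ m) {x y : BAlg K} (hx : x * bE K n = x)
    (hy : bE K m * y = y) : x * y = 0 := by
  rw [← hx, ← hy, mul_assoc, ← mul_assoc (bE K n), e_mul_e_of_ne h, zero_mul, mul_zero]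

/-- Induction over `B` as an algebra generated by the idempotents, crossings and short strands. -/
lemma induction_on {P : BAlg K → Prop} (x : BAlg K)
    (algebraMap : ∀ r, P (algebraMap K (BAlg K) r))
    (e : ∀ n, P (bE K n))
    (s : ∀ n i, 1 ≤ i → i + 1 ≤ n → P (sT K n i))
    (v : ∀ n i, 1 ≤ i → i ≤ n + 1 → P (vT K (n + 1) i))
    (mul : ∀ a b, P a → P b → P (a * b))
    (add : ∀ a b, P a → P b → P (a + b)) : P x := by
  obtain ⟨y, rfl⟩ := RingQuot.mkAlgHom_surjective K (BRel K) x
  induction y using FreeAlgebra.induction with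
  | grade0 r => simpa using algebraMap r
  | grade1 g =>
    match g with
    | .one n => exact e n
    | .s n i h1 h2 => simpa [sT_eq h1 h2, bS] using s n i h1 h2
    | .v 0 i h1 h2 => omega
    | .v (n + 1) i h1 h2 => simpa [vT_eq h1 h2, bV] using v n i h1 h2
  | mul a b ha hb => simpa using mul _ _ ha hb
  | add a b ha hb => simpa using add _ _ ha hb

/-! ### The homomorphism adding a strand -/

variable (K) in
/-- The images of the generators under the homomorphism adding a horizontal strand on top. -/
noncomputable def rhoGen : BGen → BAlg K
  | .one n => bE K (n + 1)
  | .s n i _ _ => sT K (n + 1) i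
  | .v n i _ _ => vT K (n + 1) i

lemma lift_rhoGen_eq_of_rel {a b : FreeAlgebra K BGen} (h : BRel K a b) :
    FreeAlgebra.lift K (rhoGen K) a = FreeAlgebra.lift K (rhoGen K) b := by
  induction h with
  | idem_self n => simpa [rhoGen] using e_mul_e (K := K) _
  | idem_orth n m h => simpa [rhoGen] using e_mul_e_of_ne (K := K) (by omega)
  | one_s n i h1 h2 => simpa [rhoGen] using e_mul_sT (K := K) _ _
  | s_one n i h1 h2 => simpa [rhoGen] using sT_mul_e (K := K) _ _
  | one_v n i h1 h2 =>
    obtain ⟨n, rfl⟩ : ∃ k, n = k + 1 := ⟨n - 1, by omega⟩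
    simpa [rhoGen] using e_mul_vT (K := K) _ _
  | v_one n i h1 h2 => simpa [rhoGen] using vT_mul_e (K := K) _ _
  | s_sq n i h1 h2 => simpa [rhoGen] using sT_sq (K := K) h1 (by omega)
  | braid n i h1 h2 => simpa [rhoGen] using sT_braid (K := K) h1 (by omega)
  | s_comm n i j _ _ _ _ h => simpa [rhoGen] using sT_comm (K := K) (by omega) (by omega) h
  | v_s_far n i j _ _ _ _ h =>
    obtain ⟨n, rfl⟩ : ∃ k, n = k + 1 := ⟨n - 1, by omega⟩
    simpa [rhoGen] using vT_mul_sT_far (K := K) (by omega) (by omega) h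
  | v_s_near n i j _ _ _ _ h =>
    obtain ⟨n, rfl⟩ : ∃ k, n = k + 1 := ⟨n - 1, by omega⟩
    obtain ⟨j, rfl⟩ : ∃ k, j = k + 1 := ⟨j - 1, by omega⟩
    simpa [rhoGen] using vT_mul_sT_near (K := K) (by omega) (by omega) (by omega)
  | v_v n i j _ _ _ _ h => simpa [rhoGen] using vT_mul_vT (K := K) (by omega) (by omega) h
  | slide n i h1 h2 => simpa [rhoGen] using vT_slide (K := K) h1 (by omega)

variable (K) in
/-- The homomorphism of `B` adding a horizontal strand on top. -/
noncomputable def rho : BAlg K →ₐ[K] BAlg K :=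
  RingQuot.liftAlgHom K ⟨FreeAlgebra.lift K (rhoGen K), fun _ _ => lift_rhoGen_eq_of_rel⟩

lemma rho_e (n : ℕ) : rho K (bE K n) = bE K (n + 1) := by
  simp [rho, bE, rhoGen]

lemma rho_sT {n i : ℕ} (h1 : 1 ≤ i) (h2 : i + 1 ≤ n) :
    rho K (sT K n i) = sT K (n + 1) i := by
  simp [sT_eq h1 h2, rho, bS, rhoGen]

lemma rho_vT {n i : ℕ} (h1 : 1 ≤ i) (h2 : i ≤ n) :
    rho K (vT K n i) = vT K (n + 1) i := by
  simp [vT_eq h1 h2, rho, bV, rhoGen]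

/-! ### A representation on functions of a natural number and a list -/

/-- The operator precomposing with `(a, l) ↦ (b, l.map f)`, supported on functions at `a`. -/
def op (a b : ℕ) (f : ℕ → ℕ) : Module.End K (ℕ → List ℕ → K) where
  toFun φ p l := if p = a then φ b (l.map f) else 0
  map_add' φ ψ := by ext p l; simp only [Pi.add_apply]; split_ifs <;> simp
  map_smul' r φ := by ext p l; simp

lemma op_apply (a b : ℕ) (f : ℕ → ℕ) (φ : ℕ → List ℕ → K) (p : ℕ) (l : List ℕ) :
    op a b f φ p l = if p = a then φ b (l.map f) else 0 := rfl

lemma op_mul_op (a b c : ℕ) (f g : ℕ → ℕ) :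
    (op a b f * op b c g : Module.End K _) = op a c (g ∘ f) := by
  ext φ p l
  simp [op_apply]

lemma op_mul_op_of_ne {a b b' c : ℕ} (f g : ℕ → ℕ) (h : b ≠ b') :
    (op a b f * op b' c g : Module.End K _) = 0 := by
  ext φ p l
  simp [op_apply, h]

/-- The transposition of `i` and `i + 1`. -/
def sMap (i : ℕ) : Equiv.Perm ℕ := Equiv.swap i (i + 1)

/-- The increasing map missing exactly `i`. -/
def vMap (i j : ℕ) : ℕ := if j < i then j else j + 1

lemma sMap_apply (i j : ℕ) :
    sMap i j = if j = i then i + 1 else if j = i + 1 then i else j :=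
  Equiv.swap_apply_def _ _ _

variable (K) in
/-- The operators representing the generators. -/
def opGen : BGen → Module.End K (ℕ → List ℕ → K)
  | .one n => op n n id
  | .s n i _ _ => op n n (sMap i)
  | .v n i _ _ => op (n - 1) n (vMap i)

lemma lift_opGen_eq_of_rel {a b : FreeAlgebra K BGen} (h : BRel K a b) :
    FreeAlgebra.lift K (opGen K) a = FreeAlgebra.lift K (opGen K) b := by
  induction h with
  | idem_self n => simp [opGen, op_mul_op]
  | idem_orth n m h => simp [opGen, op_mul_op_of_ne _ _ h]
  | one_s n i h1 h2 => simp [opGen, op_mul_op]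
  | s_one n i h1 h2 => simp [opGen, op_mul_op]
  | one_v n i h1 h2 => simp [opGen, op_mul_op]
  | v_one n i h1 h2 => simp [opGen, op_mul_op]
  | s_sq n i h1 h2 =>
    simp only [map_mul, FreeAlgebra.lift_ι_apply, opGen, op_mul_op]
    congr 1; ext k; simp [sMap]
  | braid n i h1 h2 =>
    simp only [map_mul, FreeAlgebra.lift_ι_apply, opGen, op_mul_op]
    congr 1; ext k; simp only [Function.comp, sMap_apply]; grind
  | s_comm n i j _ _ _ _ h =>
    simp only [map_mul, FreeAlgebra.lift_ι_apply, opGen, op_mul_op]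
    congr 1; ext k; simp only [Function.comp, sMap_apply]; grind
  | v_s_far n i j _ _ _ _ h =>
    simp only [map_mul, FreeAlgebra.lift_ι_apply, opGen, op_mul_op]
    congr 1; ext k; simp only [Function.comp, sMap_apply, vMap]; grind
  | v_s_near n i j _ _ _ _ h =>
    simp only [map_mul, FreeAlgebra.lift_ι_apply, opGen, op_mul_op]
    congr 1; ext k; simp only [Function.comp, sMap_apply, vMap]; grind
  | v_v n i j _ _ _ _ h =>
    simp only [map_mul, FreeAlgebra.lift_ι_apply, opGen, add_tsub_cancel_right, op_mul_op]
    congr 1; ext k; simp only [Function.comp, vMap]; grind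
  | slide n i h1 h2 =>
    simp only [map_mul, FreeAlgebra.lift_ι_apply, opGen, op_mul_op]
    congr 1; ext k; simp only [Function.comp, sMap_apply, vMap]; grind

variable (K) in
/-- The representation of `B` on functions of a natural number and a list. -/
noncomputable def rep : BAlg K →ₐ[K] Module.End K (ℕ → List ℕ → K) :=
  RingQuot.liftAlgHom K ⟨FreeAlgebra.lift K (opGen K), fun _ _ => lift_opGen_eq_of_rel⟩

lemma rep_e (n : ℕ) : rep K (bE K n) = op n n id := by
  simp [rep, bE, opGen]

lemma rep_sT {n i : ℕ} (h1 : 1 ≤ i) (h2 : i + 1 ≤ n) :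
    rep K (sT K n i) = op n n (sMap i) := by
  simp [sT_eq h1 h2, rep, bS, opGen]

lemma rep_vT {n i : ℕ} (h1 : 1 ≤ i) (h2 : i ≤ n + 1) :
    rep K (vT K (n + 1) i) = op n (n + 1) (vMap i) := by
  simp [vT_eq h1 h2, rep, bV, opGen]

/-- Restriction of a function to the lists whose head is the top strand. -/
def restrictTop : (ℕ → List ℕ → K) →ₗ[K] (ℕ → List ℕ → K) where
  toFun φ n l := φ (n + 1) ((n + 1) :: l)
  map_add' _ _ := rfl
  map_smul' _ _ := rfl

lemma restrictTop_apply (φ : ℕ → List ℕ → K) (n : ℕ) (l : List ℕ) :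
    restrictTop φ n l = φ (n + 1) ((n + 1) :: l) := rfl

lemma restrictTop_surjective : Function.Surjective (restrictTop (K := K)) := fun φ =>
  ⟨fun n l => φ (n - 1) l.tail, by ext n l; simp [restrictTop_apply]⟩

lemma restrictTop_rep_rho (x : BAlg K) (φ : ℕ → List ℕ → K) :
    restrictTop (rep K (rho K x) φ) = rep K x (restrictTop φ) := by
  induction x using induction_on generalizing φ with
  | algebraMap r => simp [Algebra.algebraMap_eq_smul_one]
  | e n =>
    ext p l
    simp only [rho_e, rep_e, restrictTop_apply, op_apply]
    by_cases h : p = n <;> simp [h]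
  | s n i h1 h2 =>
    ext p l
    rw [rho_sT h1 h2, rep_sT h1 h2, rep_sT h1 (by omega)]
    simp only [restrictTop_apply, op_apply]
    by_cases h : p = n
    · subst h
      have : sMap i (p + 1) = p + 1 := by rw [sMap_apply]; grind
      simp [this]
    · simp [h]
  | v n i h1 h2 =>
    ext p l
    rw [rho_vT h1 h2, rep_vT h1 h2, rep_vT h1 (by omega)]
    simp only [restrictTop_apply, op_apply]
    by_cases h : p = n
    · subst h
      have : vMap i (p + 1) = p + 1 + 1 := by rw [vMap]; grind
      simp [this]
    · simp [h]
  | mul a b ha hb => simp [ha, hb]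
  | add a b ha hb => simp [ha, hb]

lemma rep_eq_zero_of_rho {x : BAlg K} (h : rep K (rho K x) = 0) : rep K x = 0 := by
  ext1 φ
  obtain ⟨ψ, rfl⟩ := restrictTop_surjective φ
  simp [← restrictTop_rep_rho, h]

/-! ### Spanning sets -/

variable (K) in
/-- The generator `v_1(1) v_2(2) ⋯ v_n(n)` of `B(0, n)`. -/
noncomputable def u : ℕ → BAlg K
  | 0 => bE K 0
  | n + 1 => u n * vT K (n + 1) (n + 1)

lemma u_mul_e (n : ℕ) : u K n * bE K n = u K n := by
  cases n with
  | zero => exact e_mul_e 0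
  | succ n => rw [u, mul_assoc, vT_mul_e]

lemma u_mul_vT {n i : ℕ} (h1 : 1 ≤ i) (h2 : i ≤ n + 1) :
    u K n * vT K (n + 1) i = u K (n + 1) := by
  induction n with
  | zero =>
    obtain rfl : i = 1 := by omega
    rfl
  | succ n ih =>
    obtain rfl | h := h2.eq_or_lt
    · rfl
    · rw [u, mul_assoc, vT_mul_vT h1 le_rfl (by omega), ← mul_assoc, ih (by omega)]
      rfl

lemma u_mul_sT {n i : ℕ} (h1 : 1 ≤ i) (h2 : i + 1 ≤ n) : u K n * sT K n i = u K n := by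
  induction n with
  | zero => omega
  | succ n ih =>
    obtain h | h := h2.eq_or_lt
    · obtain rfl : i = n := by omega
      rw [u, mul_assoc, vT_slide_symm h1 le_rfl, u_mul_vT h1 (by omega), u]
    · rw [u, mul_assoc, vT_mul_sT_far le_rfl h1 (by omega), ← mul_assoc, ih (by omega)]

/-- A subspace stable under right multiplication by the generators is a right ideal. -/
lemma mul_mem_span {S : Set (BAlg K)}
    (he : ∀ z ∈ S, ∀ n, z * bE K n ∈ Submodule.span K S)
    (hs : ∀ z ∈ S, ∀ n i, 1 ≤ i → i + 1 ≤ n → z * sT K n i ∈ Submodule.span K S)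
    (hv : ∀ z ∈ S, ∀ n i, 1 ≤ i → i ≤ n + 1 → z * vT K (n + 1) i ∈ Submodule.span K S)
    {z : BAlg K} (hz : z ∈ Submodule.span K S) (y : BAlg K) : z * y ∈ Submodule.span K S := by
  have extend : ∀ y, (∀ z ∈ S, z * y ∈ Submodule.span K S) →
      ∀ z ∈ Submodule.span K S, z * y ∈ Submodule.span K S := fun y h z hz =>
    (Submodule.span_le (p := (Submodule.span K S).comap (LinearMap.mulRight K y))).2 h hz
  induction y using induction_on generalizing z with
  | algebraMap r =>
    rw [← Algebra.commutes, ← Algebra.smul_def]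
    exact Submodule.smul_mem _ _ hz
  | e n => exact extend _ (fun z hz => he z hz n) z hz
  | s n i h1 h2 => exact extend _ (fun z hz => hs z hz n i h1 h2) z hz
  | v n i h1 h2 => exact extend _ (fun z hz => hv z hz n i h1 h2) z hz
  | mul a b ha hb => rw [← mul_assoc]; exact hb (ha hz)
  | add a b ha hb => rw [mul_add]; exact Submodule.add_mem _ (ha hz) (hb hz)

lemma e_zero_mul_mem (y : BAlg K) : bE K 0 * y ∈ Submodule.span K (Set.range (u K)) := by
  refine mul_mem_span ?_ ?_ ?_ (Submodule.subset_span (Set.mem_range_self 0)) y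
  · rintro _ ⟨p, rfl⟩ n
    by_cases h : p = n
    · subst h
      exact Submodule.subset_span ⟨p, (u_mul_e p).symm⟩
    · simp [mul_eq_zero_of_ne h (u_mul_e p) (e_mul_e n)]
  · rintro _ ⟨p, rfl⟩ n i h1 h2
    by_cases h : p = n
    · subst h
      exact Submodule.subset_span ⟨p, (u_mul_sT h1 h2).symm⟩
    · simp [mul_eq_zero_of_ne h (u_mul_e p) (e_mul_sT n i)]
  · rintro _ ⟨p, rfl⟩ n i h1 h2
    by_cases h : p = n
    · subst h
      exact Submodule.subset_span ⟨p + 1, (u_mul_vT h1 h2).symm⟩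
    · simp [mul_eq_zero_of_ne h (u_mul_e p) (e_mul_vT n i)]

lemma exists_eq_smul_u {n : ℕ} {x : BAlg K} (h0 : bE K 0 * x = x) (hn : x * bE K n = x) :
    ∃ a : K, x = a • u K n := by
  have hx := e_zero_mul_mem x
  rw [h0] at hx
  rw [← hn]
  clear h0 hn
  induction hx using Submodule.span_induction with
  | mem x hx =>
    obtain ⟨p, rfl⟩ := hx
    by_cases h : p = n
    · exact ⟨1, by rw [h, u_mul_e, one_smul]⟩
    · exact ⟨0, by rw [mul_eq_zero_of_ne h (u_mul_e p) (e_mul_e n), zero_smul]⟩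
  | zero => exact ⟨0, by simp⟩
  | add x y _ _ hx hy =>
    obtain ⟨a, ha⟩ := hx
    obtain ⟨b, hb⟩ := hy
    exact ⟨a + b, by rw [add_mul, ha, hb, add_smul]⟩
  | smul r x _ hx =>
    obtain ⟨a, ha⟩ := hx
    exact ⟨r * a, by rw [smul_mul_assoc, ha, mul_smul]⟩

variable (K) in
/-- The cycle `s_q ⋯ s_{q+1-t}` in `B(q+1, q+1)`, moving the top strand down by `t`. -/
noncomputable def c (q : ℕ) : ℕ → BAlg K
  | 0 => bE K (q + 1)
  | t + 1 => c q t * sT K (q + 1) (q - t)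

lemma c_mul_e (q t : ℕ) : c K q t * bE K (q + 1) = c K q t := by
  cases t with
  | zero => exact e_mul_e _
  | succ t => rw [c, mul_assoc, sT_mul_e]

lemma c_succ_mul_sT {q t : ℕ} (ht : t < q) :
    c K q (t + 1) * sT K (q + 1) (q - t) = c K q t := by
  rw [c, mul_assoc, sT_sq (by omega) (by omega), c_mul_e]

lemma c_mul_sT_of_lt {q t i : ℕ} (h1 : 1 ≤ i) (h : i + t < q) :
    c K q t * sT K (q + 1) i = sT K (q + 1) i * c K q t := by
  induction t with
  | zero => rw [c, e_mul_sT, sT_mul_e]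
  | succ t ih =>
    rw [c, mul_assoc, ← sT_comm h1 (by omega) (by omega), ← mul_assoc, ih (by omega), mul_assoc]

lemma c_mul_sT_of_gt {q t i : ℕ} (ht : t ≤ q) (hi : i + 1 ≤ q) (h : q < i + t) :
    c K q t * sT K (q + 1) (i + 1) = sT K (q + 1) i * c K q t := by
  induction t with
  | zero => omega
  | succ t ih =>
    by_cases h' : q < i + t
    · rw [c, mul_assoc, sT_comm (by omega) (by omega) (by omega), ← mul_assoc,
        ih (by omega) h', mul_assoc]
    · cases t with
      | zero => omega
      | succ t =>
        obtain rfl : q = i + t + 1 := by omega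
        have h1 : i + t + 1 - t = i + 1 := by omega
        have h2 : i + t + 1 - (t + 1) = i := by omega
        rw [c, c, h1, h2]
        calc c K (i + t + 1) t * sT K (i + t + 1 + 1) (i + 1) * sT K (i + t + 1 + 1) i *
              sT K (i + t + 1 + 1) (i + 1)
            = c K (i + t + 1) t * (sT K (i + t + 1 + 1) (i + 1) * sT K (i + t + 1 + 1) i *
              sT K (i + t + 1 + 1) (i + 1)) := by simp only [mul_assoc]
          _ = (c K (i + t + 1) t * sT K (i + t + 1 + 1) i) * sT K (i + t + 1 + 1) (i + 1) *
              sT K (i + t + 1 + 1) i := by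
              rw [← sT_braid (by omega) (by omega)]; simp only [mul_assoc]
          _ = _ := by
              rw [c_mul_sT_of_lt (by omega) (by omega)]; simp only [mul_assoc]

lemma c_mul_vT_of_le {q t i : ℕ} (h1 : 1 ≤ i) (h : i + t ≤ q + 1) :
    c K q t * vT K (q + 2) i = vT K (q + 2) i * c K (q + 1) t := by
  induction t with
  | zero => rw [c, c, e_mul_vT, vT_mul_e]
  | succ t ih =>
    have h2 : q + 1 - t = q - t + 1 := by omega
    rw [c, c, mul_assoc, h2, ← vT_mul_sT_near h1 (by omega) (by omega), ← mul_assoc,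
      ih (by omega), mul_assoc]

lemma c_mul_vT_of_gt {q t i : ℕ} (ht : t ≤ q) (hi : i ≤ q + 1) (h : q < i + t) :
    c K q t * vT K (q + 2) (i + 1) = vT K (q + 2) i * c K (q + 1) (t + 1) := by
  induction t with
  | zero =>
    obtain rfl : i = q + 1 := by omega
    rw [c, c, c, e_mul_vT, ← mul_assoc, vT_mul_e]
    exact (vT_slide (by omega) le_rfl).symm
  | succ t ih =>
    by_cases h' : q < i + t
    · have h2 : q + 1 - (t + 1) = q - t := by omega
      rw [c, mul_assoc, ← vT_mul_sT_far (by omega) (by omega) (by omega), ← mul_assoc,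
        ih (by omega) h', mul_assoc, c.eq_def K (q + 1) (t + 1 + 1)]
      simp only [h2]
    · obtain rfl : q = i + t := by omega
      have h1 : i + t - t = i := by omega
      have h2 : i + t + 1 - t = i + 1 := by omega
      have h3 : i + t + 1 - (t + 1) = i := by omega
      rw [c, c, c, h1, h2, h3, ← mul_assoc, ← mul_assoc, ← c_mul_vT_of_le (by omega) (by omega),
        mul_assoc (c K _ _) (vT K _ _), vT_mul_sT_near (by omega) (by omega) le_rfl, mul_assoc,
        mul_assoc, mul_assoc, vT_slide (by omega) (by omega)]

variable (K) in
/-- The products `ρ(x) c` for `x ∈ B(m, q)` and a cycle `c ∈ B(q+1, q+1)`. -/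
def cycleProducts (m : ℕ) : Set (BAlg K) :=
  {z | ∃ q t x, t ≤ q ∧ bE K m * x = x ∧ x * bE K q = x ∧ z = rho K x * c K q t}

lemma rho_mul_c_mem {m q t : ℕ} {x : BAlg K} (ht : t ≤ q) (h1 : bE K m * x = x)
    (h2 : x * bE K q = x) : rho K x * c K q t ∈ Submodule.span K (cycleProducts K m) :=
  Submodule.subset_span ⟨q, t, x, ht, h1, h2, rfl⟩

lemma rho_mul_c_mul_e (x : BAlg K) (q t : ℕ) :
    rho K x * c K q t * bE K (q + 1) = rho K x * c K q t := by
  rw [mul_assoc, c_mul_e]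

lemma e_succ_mul_mem (m : ℕ) (y : BAlg K) :
    bE K (m + 1) * y ∈ Submodule.span K (cycleProducts K m) := by
  refine mul_mem_span ?_ ?_ ?_ ?_ y
  · rintro _ ⟨q, t, x, ht, h1, h2, rfl⟩ n
    by_cases h : q + 1 = n
    · subst h
      rw [rho_mul_c_mul_e]
      exact rho_mul_c_mem ht h1 h2
    · simp [mul_eq_zero_of_ne h (rho_mul_c_mul_e x q t) (e_mul_e n)]
  · rintro _ ⟨q, t, x, ht, h1, h2, rfl⟩ n i hi1 hi2
    by_cases h : q + 1 = n
    · subst h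
      rw [mul_assoc]
      obtain h | h | h | h : i + t < q ∨ i + t = q ∨ i + t = q + 1 ∨ q + 1 < i + t := by omega
      · rw [c_mul_sT_of_lt hi1 h, ← rho_sT hi1 (by omega), ← mul_assoc, ← map_mul]
        exact rho_mul_c_mem ht (by rw [← mul_assoc, h1]) (by rw [mul_assoc, sT_mul_e])
      · obtain rfl : i = q - t := by omega
        exact rho_mul_c_mem (t := t + 1) (by omega) h1 h2
      · obtain ⟨t, rfl⟩ : ∃ t', t = t' + 1 := ⟨t - 1, by omega⟩
        obtain rfl : i = q - t := by omega
        rw [c_succ_mul_sT (by omega)]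
        exact rho_mul_c_mem (by omega) h1 h2
      · obtain ⟨i, rfl⟩ : ∃ i', i = i' + 1 := ⟨i - 1, by omega⟩
        rw [c_mul_sT_of_gt ht (by omega) (by omega), ← rho_sT (by omega) (by omega),
          ← mul_assoc, ← map_mul]
        exact rho_mul_c_mem ht (by rw [← mul_assoc, h1]) (by rw [mul_assoc, sT_mul_e])
    · simp [mul_eq_zero_of_ne h (rho_mul_c_mul_e x q t) (e_mul_sT n i)]
  · rintro _ ⟨q, t, x, ht, h1, h2, rfl⟩ n i hi1 hi2
    by_cases h : q + 1 = n
    · subst h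
      rw [mul_assoc]
      obtain h | h : i + t ≤ q + 1 ∨ q + 1 < i + t := by omega
      · rw [c_mul_vT_of_le hi1 h, ← rho_vT hi1 (by omega), ← mul_assoc, ← map_mul]
        exact rho_mul_c_mem (by omega) (by rw [← mul_assoc, h1]) (by rw [mul_assoc, vT_mul_e])
      · obtain ⟨i, rfl⟩ : ∃ i', i = i' + 1 := ⟨i - 1, by omega⟩
        rw [c_mul_vT_of_gt ht (by omega) (by omega), ← rho_vT (by omega) (by omega),
          ← mul_assoc, ← map_mul]
        exact rho_mul_c_mem (by omega) (by rw [← mul_assoc, h1]) (by rw [mul_assoc, vT_mul_e])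
    · simp [mul_eq_zero_of_ne h (rho_mul_c_mul_e x q t) (e_mul_vT n i)]
  · have h := rho_mul_c_mem (K := K) (m := m) (t := 0) (Nat.zero_le _) (e_mul_e m) (e_mul_e m)
    rwa [rho_e, c, e_mul_e] at h

lemma exists_eq_sum_rho_mul_c {m q : ℕ} {x : BAlg K} (hm : bE K (m + 1) * x = x)
    (hq : x * bE K (q + 1) = x) :
    ∃ y : ℕ → BAlg K, (∀ t, bE K m * y t = y t ∧ y t * bE K q = y t) ∧
      x = ∑ t ∈ Finset.range (q + 1), rho K (y t) * c K q t := by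
  have hx := e_succ_mul_mem m x
  rw [hm] at hx
  rw [← hq]
  clear hm hq
  induction hx using Submodule.span_induction with
  | mem x hx =>
    obtain ⟨p, t, x, ht, h1, h2, rfl⟩ := hx
    by_cases h : p = q
    · subst h
      refine ⟨fun r => if r = t then x else 0, fun r => ?_, ?_⟩
      · by_cases hr : r = t <;> simp [hr, h1, h2]
      · rw [rho_mul_c_mul_e, Finset.sum_eq_single t] <;> grind
    · refine ⟨0, by simp, ?_⟩
      rw [mul_eq_zero_of_ne (n := p + 1) (by omega) (rho_mul_c_mul_e x p t) (e_mul_e (q + 1))]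
      simp
  | zero => exact ⟨0, by simp, by simp⟩
  | add x x' _ _ hx hx' =>
    obtain ⟨y, hy, e⟩ := hx
    obtain ⟨y', hy', e'⟩ := hx'
    refine ⟨y + y', fun t => ?_, ?_⟩
    · simp [mul_add, add_mul, hy, hy']
    · simp [add_mul, e, e', Finset.sum_add_distrib]
  | smul r x _ hx =>
    obtain ⟨y, hy, e⟩ := hx
    refine ⟨r • y, fun t => ?_, ?_⟩
    · simp [hy]
    · simp [e, Finset.smul_sum]

lemma eq_zero_of_e_succ_of_e_zero {m : ℕ} {x : BAlg K} (hm : bE K (m + 1) * x = x)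
    (h0 : x * bE K 0 = x) : x = 0 := by
  have hx := e_succ_mul_mem m x
  rw [hm] at hx
  rw [← h0]
  refine (Submodule.span_le (p := LinearMap.ker (LinearMap.mulRight K (bE K 0)))).2 ?_ hx
  rintro _ ⟨q, t, x, -, -, -, rfl⟩
  exact mul_eq_zero_of_ne (by omega) (rho_mul_c_mul_e x q t) (e_mul_e 0)

/-! ### Faithfulness -/

lemma exists_rep_u (n : ℕ) : ∃ f, rep K (u K n) = op 0 n f := by
  induction n with
  | zero => exact ⟨_, rep_e 0⟩
  | succ n ih =>
    obtain ⟨f, hf⟩ := ih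
    exact ⟨_, by rw [u, map_mul, hf, rep_vT (by omega) le_rfl, op_mul_op]⟩

lemma exists_rep_c {q t : ℕ} (ht : t ≤ q) :
    ∃ γ : Equiv.Perm ℕ, rep K (c K q t) = op (q + 1) (q + 1) γ ∧ γ (q + 1) = q + 1 - t := by
  induction t with
  | zero => exact ⟨1, rep_e _, rfl⟩
  | succ t ih =>
    obtain ⟨γ, h, h'⟩ := ih (by omega)
    refine ⟨γ.trans (sMap (q - t)), ?_, ?_⟩
    · rw [c, map_mul, h, rep_sT (by omega) (by omega), op_mul_op, Equiv.coe_trans]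
    · rw [Equiv.trans_apply, h', sMap_apply]
      grind

lemma exists_restrictTop_rep_c {q j : ℕ} (hj : j ≤ q) (θ : ℕ → List ℕ → K) :
    ∃ φ : ℕ → List ℕ → K, ∀ t ≤ q,
      restrictTop (rep K (c K q t) φ) = if t = j then rep K (bE K q) θ else 0 := by
  choose! γ hγ hγ' using fun t (ht : t ≤ q) => exists_rep_c (K := K) ht
  refine ⟨fun p l => if l.head? = some (q + 1 - j) then θ (p - 1) (l.tail.map (γ j).symm) else 0,
    fun t ht => ?_⟩
  ext p l
  rw [restrictTop_apply, hγ t ht, op_apply]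
  by_cases hp : p = q
  · subst hp
    by_cases h : t = j
    · subst h
      simp [hγ' t ht, rep_e, op_apply]
    · have : p + 1 - t ≠ p + 1 - j := by omega
      simp [hγ' t ht, h, this]
  · split_ifs <;> simp_all [rep_e, op_apply]

lemma eq_zero_of_rep_eq_zero {m n : ℕ} {x : BAlg K} (hm : bE K m * x = x)
    (hn : x * bE K n = x) (h : rep K x = 0) : x = 0 := by
  induction m generalizing n x with
  | zero =>
    obtain ⟨a, rfl⟩ := exists_eq_smul_u hm hn
    obtain ⟨f, hf⟩ := exists_rep_u (K := K) n
    have := congrFun (congrFun (LinearMap.congr_fun h (fun _ _ => 1)) 0) []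
    simp only [map_smul, hf, LinearMap.smul_apply, Pi.smul_apply, op_apply] at this
    simp_all
  | succ m ih =>
    cases n with
    | zero => exact eq_zero_of_e_succ_of_e_zero hm hn
    | succ q =>
      obtain ⟨y, hy, rfl⟩ := exists_eq_sum_rho_mul_c hm hn
      refine Finset.sum_eq_zero fun j hj => ?_
      have hj : j ≤ q := by simpa [Nat.lt_succ_iff] using hj
      suffices y j = 0 by simp [this]
      refine ih (hy j).1 (hy j).2 ?_
      ext1 θ
      obtain ⟨φ, hφ⟩ := exists_restrictTop_rep_c hj θ
      have := congrArg restrictTop (LinearMap.congr_fun h φ)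
      rw [map_sum, LinearMap.sum_apply, map_sum, Finset.sum_eq_single_of_mem j (by simpa using hj)]
        at this
      · rw [map_mul, Module.End.mul_apply, restrictTop_rep_rho, hφ j hj, if_pos rfl,
          ← Module.End.mul_apply, ← map_mul, (hy j).2] at this
        simpa using this
      · intro t ht htj
        rw [map_mul, Module.End.mul_apply, restrictTop_rep_rho,
          hφ t (by simpa [Nat.lt_succ_iff] using ht), if_neg htj, map_zero]

lemma mem_Bspace_iff {m n : ℕ} {x : BAlg K} :
    x ∈ Bspace K m n ↔ bE K m * x = x ∧ x * bE K n = x := by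
  constructor
  · rintro ⟨y, rfl⟩
    constructor
    · simp [← mul_assoc, e_mul_e]
    · simp [mul_assoc, e_mul_e]
  · rintro ⟨h1, h2⟩
    exact ⟨x, by simp [h1, h2]⟩

/-- An element of the idempotented part of `B` is the sum of its components. -/
lemma exists_eq_sum_components {z : BAlg K} (hz : z ∈ ⨆ p : ℕ × ℕ, Bspace K p.1 p.2) :
    ∃ S : Finset (ℕ × ℕ), ∀ S', S ⊆ S' → z = ∑ p ∈ S', bE K p.1 * z * bE K p.2 := by
  induction hz using Submodule.iSup_induction' with
  | mem p z hz =>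
    obtain ⟨h1, h2⟩ := mem_Bspace_iff.1 hz
    refine ⟨{p}, fun S' hS' => ?_⟩
    rw [Finset.sum_eq_single_of_mem p (by simpa using hS'), h1, h2]
    intro r _ hr
    by_cases h : r.1 = p.1
    · have h' : p.2 ≠ r.2 := fun h' => hr (Prod.ext h h'.symm)
      rw [mul_assoc, mul_eq_zero_of_ne h' h2 (e_mul_e _), mul_zero]
    · rw [mul_eq_zero_of_ne h (e_mul_e _) h1, zero_mul]
  | zero => exact ⟨∅, by simp⟩
  | add x y _ _ hx hy =>
    obtain ⟨S, hS⟩ := hx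
    obtain ⟨T, hT⟩ := hy
    refine ⟨S ∪ T, fun S' h => ?_⟩
    simp only [mul_add, add_mul, Finset.sum_add_distrib]
    rw [← hS S' (Finset.union_subset_left h), ← hT S' (Finset.union_subset_right h)]

lemma rho_injOn : Set.InjOn (rho K) (↑(⨆ p : ℕ × ℕ, Bspace K p.1 p.2) : Set (BAlg K)) := by
  intro x hx y hy hxy
  have hrep : rep K (x - y) = 0 := rep_eq_zero_of_rho (by rw [map_sub, hxy, sub_self, map_zero])
  obtain ⟨S, hS⟩ := exists_eq_sum_components (Submodule.sub_mem _ hx hy)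
  rw [← sub_eq_zero, hS S subset_rfl]
  refine Finset.sum_eq_zero fun p _ => eq_zero_of_rep_eq_zero (m := p.1) (n := p.2) ?_ ?_ ?_
  · simp only [← mul_assoc, e_mul_e]
  · rw [mul_assoc, e_mul_e]
  · simp [hrep]

end BAlg

/-- There is a (non-unital) `K`-algebra homomorphism `ρ : B → B` determined on
the generators by `ρ(1(n)) = 1(n+1)`, `ρ(s_i(n)) = s_i(n+1)`,
`ρ(v_i(n)) = v_i(n+1)` (diagrammatically, adding a horizontal strand on top);
it maps `B(m,n)` into `B(m+1,n+1)` and is injective on the non-unital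
idempotented part `⊕_{m,n} B(m,n)` of `B`. -/
theorem rho_exists_injective (K : Type) [Field K] [CharZero K] :
    ∃ ρ : BAlg K →ₐ[K] BAlg K,
      (∀ n : ℕ, ρ (bE K n) = bE K (n + 1)) ∧
      (∀ (n i : ℕ) (h1 : 1 ≤ i) (h2 : i + 1 ≤ n),
        ρ (bS K n i h1 h2) = bS K (n + 1) i h1 (by omega)) ∧
      (∀ (n i : ℕ) (h1 : 1 ≤ i) (h2 : i ≤ n),
        ρ (bV K n i h1 h2) = bV K (n + 1) i h1 (by omega)) ∧
      (∀ m n : ℕ, ∀ x ∈ Bspace K m n, ρ x ∈ Bspace K (m + 1) (n + 1)) ∧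
      Set.InjOn ρ (↑(⨆ p : ℕ × ℕ, Bspace K p.1 p.2) : Set (BAlg K)) := by
  refine ⟨BAlg.rho K, BAlg.rho_e, fun n i h1 h2 => ?_, fun n i h1 h2 => ?_, fun m n x hx => ?_,
    BAlg.rho_injOn⟩
  · rw [← BAlg.sT_eq, BAlg.rho_sT h1 h2, BAlg.sT_eq]
  · rw [← BAlg.vT_eq, BAlg.rho_vT h1 h2, BAlg.vT_eq]
  · rw [BAlg.mem_Bspace_iff] at hx ⊢
    rw [← BAlg.rho_e, ← BAlg.rho_e, ← map_mul, ← map_mul, hx.1, hx.2]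
    exact ⟨rfl, rfl⟩
end

section
/- For all partitions λ = (λ_1, λ_2, …) and μ = (μ_1, μ_2, …): if λ is interlaced under μ (i.e. μ_i ≥ λ_i ≥ μ_{i+1} for all i ≥ 1), then the K-vector space (λ)F(μ) is one-dimensional; otherwise (λ)F(μ) = 0. -/
/-- Partitions, encoded as weakly decreasing finitely supported sequences
`λ = (λ_1, λ_2, …)` of natural numbers (0-based: entry `i` is `λ_{i+1}`). -/
def Ptn : Type := {f : ℕ →₀ ℕ // ∀ i, f (i + 1) ≤ f i}

/-- The size `|λ|` of a partition. -/
def ptnSize (l : Ptn) : ℕ := l.1.sum fun _ m => m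

/-- The covering relation of the Young lattice: `λ ⊆ μ` and `|μ| = |λ| + 1`,
i.e. there is an arrow `λ → μ` in the quiver `Γ`. -/
def PCovers (l m : Ptn) : Prop := (∀ i, l.1 i ≤ m.1 i) ∧ ptnSize m = ptnSize l + 1

/-- `η∖λ` consists of two boxes in the same column, i.e. `η∖λ = (1²)`. -/
def SameColumn (l h : Ptn) : Prop :=
  ∃ i, h.1 i = l.1 i + 1 ∧ h.1 (i + 1) = l.1 (i + 1) + 1 ∧ l.1 i = l.1 (i + 1) ∧
    ∀ r, r ≠ i → r ≠ i + 1 → h.1 r = l.1 r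

/-- Generators of the quiver algebra `F`: an idempotent `(λ)` for each vertex and
a generator `(λ|μ)` for each arrow `λ → μ` of `Γ`. -/
inductive FGen : Type where
  | idem (l : Ptn)
  | arr (l m : Ptn)

variable (K : Type) [Field K] [CharZero K]

/-- The defining relations of the algebra `F`: the path algebra relations of the
quiver `Γ` together with the commuting-square relations
`(λ|μ)(μ|η) = (λ|ν)(ν|η)` and the relations `(λ|μ)(μ|η) = 0` when
`η∖λ = (1²)`. -/
inductive FRel : FreeAlgebra K FGen → FreeAlgebra K FGen → Prop where
  | idem_sq (l : Ptn) :
      FRel (FreeAlgebra.ι K (FGen.idem l) * FreeAlgebra.ι K (FGen.idem l))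
        (FreeAlgebra.ι K (FGen.idem l))
  | idem_orth (l m : Ptn) (h : l ≠ m) :
      FRel (FreeAlgebra.ι K (FGen.idem l) * FreeAlgebra.ι K (FGen.idem m)) 0
  | arr_not_cover (l m : Ptn) (h : ¬ PCovers l m) :
      FRel (FreeAlgebra.ι K (FGen.arr l m)) 0
  | idem_arr (l m : Ptn) :
      FRel (FreeAlgebra.ι K (FGen.idem l) * FreeAlgebra.ι K (FGen.arr l m))
        (FreeAlgebra.ι K (FGen.arr l m))
  | idem_arr_ne (l m n : Ptn) (h : n ≠ l) :
      FRel (FreeAlgebra.ι K (FGen.idem n) * FreeAlgebra.ι K (FGen.arr l m)) 0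
  | arr_idem (l m : Ptn) :
      FRel (FreeAlgebra.ι K (FGen.arr l m) * FreeAlgebra.ι K (FGen.idem m))
        (FreeAlgebra.ι K (FGen.arr l m))
  | arr_idem_ne (l m n : Ptn) (h : n ≠ m) :
      FRel (FreeAlgebra.ι K (FGen.arr l m) * FreeAlgebra.ι K (FGen.idem n)) 0
  | square (l m n e : Ptn) (h1 : PCovers l m) (h2 : PCovers l n) (h3 : PCovers m e)
      (h4 : PCovers n e) (h : m ≠ n) :
      FRel (FreeAlgebra.ι K (FGen.arr l m) * FreeAlgebra.ι K (FGen.arr m e))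
        (FreeAlgebra.ι K (FGen.arr l n) * FreeAlgebra.ι K (FGen.arr n e))
  | column (l m e : Ptn) (h1 : PCovers l m) (h2 : PCovers m e) (h : SameColumn l e) :
      FRel (FreeAlgebra.ι K (FGen.arr l m) * FreeAlgebra.ι K (FGen.arr m e)) 0

/-- The algebra `F`. -/
abbrev FAlg : Type := RingQuot (FRel K)

/-- The idempotent `(λ) ∈ F`. -/
def eP (l : Ptn) : FAlg K := RingQuot.mkAlgHom K (FRel K) (FreeAlgebra.ι K (FGen.idem l))

/-- The arrow generator `(λ|μ) ∈ F`. -/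
def aP (l m : Ptn) : FAlg K := RingQuot.mkAlgHom K (FRel K) (FreeAlgebra.ι K (FGen.arr l m))

/-- The component `(λ)F(μ) = (λ)·F·(μ)`. -/
def Fspace (l m : Ptn) : Submodule K (FAlg K) :=
  LinearMap.range ((LinearMap.mulLeft K (eP K l)).comp (LinearMap.mulRight K (eP K m)))

/-- `λ` is interlaced under `μ`: `μ_i ≥ λ_i ≥ μ_{i+1}` for all `i ≥ 1`. -/
def Interlaced (l m : Ptn) : Prop := ∀ i, l.1 i ≤ m.1 i ∧ m.1 (i + 1) ≤ l.1 i

theorem ptn_antitone (l : Ptn) (i : ℕ) : l.1 (i + 1) ≤ l.1 i := l.2 i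

theorem ptn_ext {l m : Ptn} (h : ∀ i, l.1 i = m.1 i) : l = m :=
  Subtype.ext (Finsupp.ext h)

theorem pCovers_iff {l m : Ptn} :
    PCovers l m ↔ ∃ i, m.1 = l.1 + Finsupp.single i 1 := by
  constructor
  · rintro ⟨hle, hs⟩
    have hle' : l.1 ≤ m.1 := hle
    obtain ⟨d, hd⟩ := exists_add_of_le hle'
    have h1 : d.sum (fun _ n => n) = 1 := by
      simp only [ptnSize, hd] at hs
      rw [Finsupp.sum_add_index' (by simp) (by simp)] at hs
      omega
    obtain ⟨i, hi⟩ := (Finsupp.sum_eq_one_iff d).1 h1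
    exact ⟨i, by rw [hd, hi]⟩
  · rintro ⟨i, hi⟩
    refine ⟨fun j => by simp [hi], ?_⟩
    simp only [ptnSize, hi]
    rw [Finsupp.sum_add_index' (by simp) (by simp)]
    simp

/-- The covering relation, coordinatewise: exactly one row grows, by one box. -/
theorem pCovers_iff_row {l m : Ptn} :
    PCovers l m ↔ ∃ i, m.1 i = l.1 i + 1 ∧ ∀ j, j ≠ i → m.1 j = l.1 j := by
  rw [pCovers_iff]
  refine exists_congr fun i => ⟨fun h => ?_, fun ⟨h1, h2⟩ => ?_⟩
  · exact ⟨by simp [h], fun j hj => by simp [h, hj.symm]⟩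
  · ext j
    by_cases hj : j = i
    · subst hj; simp [h1]
    · simp [h2 j hj, Ne.symm hj]

/-- A box may be added to row `i` of `l` when the row above, if any, is strictly longer. -/
theorem exists_add_box (l : Ptn) (i : ℕ) (h : ∀ j, j + 1 = i → l.1 i < l.1 j) :
    ∃ n : Ptn, n.1 i = l.1 i + 1 ∧ ∀ j, j ≠ i → n.1 j = l.1 j := by
  have hv : ∀ j, (l.1 + Finsupp.single i 1 : ℕ →₀ ℕ) j = l.1 j + if i = j then 1 else 0 := fun j => by
    simp [Finsupp.single_apply]
  refine ⟨⟨l.1 + Finsupp.single i 1, fun j => ?_⟩, by simp, fun j hj => ?_⟩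
  · have h1 := ptn_antitone l j
    have h2 := h j
    rw [hv, hv]
    split_ifs <;> first | omega | (subst_vars; omega)
  · simp [hj.symm]

/-- Below any strictly larger partition there is a cover of the smaller one. -/
theorem exists_pCovers_le {l m : Ptn} (h : ∀ i, l.1 i ≤ m.1 i) (hne : l ≠ m) :
    ∃ n, PCovers l n ∧ ∀ i, n.1 i ≤ m.1 i := by
  classical
  have hex : ∃ i, l.1 i < m.1 i := by
    by_contra! hc
    exact hne (ptn_ext fun i => le_antisymm (h i) (hc i))
  have hi := Nat.find_spec hex
  have hmin : ∀ j < Nat.find hex, ¬ l.1 j < m.1 j := fun j hj => Nat.find_min hex hj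
  set i := Nat.find hex
  obtain ⟨n, hn1, hn2⟩ := exists_add_box l i fun j hj => by
    have h1 := hmin j (by omega)
    have h2 := ptn_antitone m j
    rw [hj] at h2
    omega
  refine ⟨n, pCovers_iff_row.2 ⟨i, hn1, hn2⟩, fun j => ?_⟩
  by_cases hj : j = i
  · subst hj; omega
  · rw [hn2 j hj]; exact h j

/-- Two distinct covers of `l` are completed to a commuting square by their union. -/
theorem exists_square {l m n t : Ptn} (hm : PCovers l m) (hn : PCovers l n) (hmn : m ≠ n)
    (hmt : ∀ i, m.1 i ≤ t.1 i) (hnt : ∀ i, n.1 i ≤ t.1 i) :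
    ∃ e, PCovers m e ∧ PCovers n e ∧ ∀ i, e.1 i ≤ t.1 i := by
  obtain ⟨i, hi, hi'⟩ := pCovers_iff_row.1 hm
  obtain ⟨j, hj, hj'⟩ := pCovers_iff_row.1 hn
  have hij : i ≠ j := by
    rintro rfl
    refine hmn (ptn_ext fun k => ?_)
    by_cases hk : k = i
    · rw [hk, hi, hj]
    · rw [hi' k hk, hj' k hk]
  obtain ⟨e, he, he'⟩ := exists_add_box m j fun k hk => by
    have h1 := ptn_antitone n k
    have h2 := hm.1 k
    rw [hk, hj, hj' k (by omega)] at h1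
    rw [hi' j hij.symm]
    omega
  refine ⟨e, pCovers_iff_row.2 ⟨j, he, he'⟩, pCovers_iff_row.2 ⟨i, ?_, fun k hk => ?_⟩,
    fun k => ?_⟩
  · rw [he' i hij, hi, hj' i hij]
  · by_cases hkj : k = j
    · rw [hkj, he, hj, hi' j hij.symm]
    · rw [he' k hkj, hi' k hk, hj' k hkj]
  · by_cases hkj : k = j
    · rw [hkj, he, hi' j hij.symm, ← hj]; exact hnt j
    · rw [he' k hkj]; exact hmt k

theorem Interlaced.of_le_of_le {l n m : Ptn} (h : Interlaced l m) (hln : ∀ i, l.1 i ≤ n.1 i)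
    (hnm : ∀ i, n.1 i ≤ m.1 i) : Interlaced n m :=
  fun i => ⟨hnm i, (h i).2.trans (hln i)⟩

variable (K : Type) [Field K]

theorem mk_eq_of_fRel {a b : FreeAlgebra K FGen} (h : FRel K a b) :
    RingQuot.mkAlgHom K (FRel K) a = RingQuot.mkAlgHom K (FRel K) b :=
  RingQuot.mkAlgHom_rel K h

theorem eP_mul_self (l : Ptn) : eP K l * eP K l = eP K l := by
  simpa [eP] using mk_eq_of_fRel K (FRel.idem_sq l)

theorem eP_mul_eP_of_ne {l m : Ptn} (h : l ≠ m) : eP K l * eP K m = 0 := by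
  simpa [eP] using mk_eq_of_fRel K (FRel.idem_orth l m h)

theorem aP_eq_zero {l m : Ptn} (h : ¬ PCovers l m) : aP K l m = 0 := by
  simpa [aP] using mk_eq_of_fRel K (FRel.arr_not_cover l m h)

theorem eP_mul_aP (l m : Ptn) : eP K l * aP K l m = aP K l m := by
  simpa [eP, aP] using mk_eq_of_fRel K (FRel.idem_arr l m)

theorem aP_mul_eP (l m : Ptn) : aP K l m * eP K m = aP K l m := by
  simpa [eP, aP] using mk_eq_of_fRel K (FRel.arr_idem l m)

theorem aP_mul_aP_square {l m n e : Ptn} (h1 : PCovers l m) (h2 : PCovers l n)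
    (h3 : PCovers m e) (h4 : PCovers n e) (h : m ≠ n) :
    aP K l m * aP K m e = aP K l n * aP K n e := by
  simpa [aP] using mk_eq_of_fRel K (FRel.square l m n e h1 h2 h3 h4 h)

theorem aP_mul_aP_column {l m e : Ptn} (h1 : PCovers l m) (h2 : PCovers m e)
    (h : SameColumn l e) : aP K l m * aP K m e = 0 := by
  simpa [aP] using mk_eq_of_fRel K (FRel.column l m e h1 h2 h)

/-- `IsPath K l m x`: the element `x` of `F` is the class of a path from `l` to `m` in `Γ`. -/
inductive IsPath : Ptn → Ptn → FAlg K → Prop where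
  | nil (l : Ptn) : IsPath l l (eP K l)
  | cons {l n m : Ptn} {x : FAlg K} (h : PCovers l n) (hx : IsPath n m x) :
      IsPath l m (aP K l n * x)

variable {K}

theorem IsPath.le {l m : Ptn} {x : FAlg K} (h : IsPath K l m x) : ∀ i, l.1 i ≤ m.1 i := by
  induction h with
  | nil l => exact fun i => le_rfl
  | cons h _ ih => exact fun i => (h.1 i).trans (ih i)

theorem IsPath.size_le {l m : Ptn} {x : FAlg K} (h : IsPath K l m x) :
    ptnSize l ≤ ptnSize m := by
  induction h with
  | nil l => exact le_rfl
  | cons h _ ih => have := h.2; omega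

theorem IsPath.eP_mul {l m : Ptn} {x : FAlg K} (h : IsPath K l m x) : eP K l * x = x := by
  cases h with
  | nil => exact eP_mul_self K l
  | cons h hx => rw [← mul_assoc, eP_mul_aP]

theorem IsPath.mul_eP {l m : Ptn} {x : FAlg K} (h : IsPath K l m x) : x * eP K m = x := by
  induction h with
  | nil l => exact eP_mul_self K l
  | cons h _ ih => rw [mul_assoc, ih]

variable (K)

theorem exists_isPath {l m : Ptn} (h : ∀ i, l.1 i ≤ m.1 i) : ∃ x, IsPath K l m x := by
  induction hd : ptnSize m - ptnSize l using Nat.strong_induction_on generalizing l with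
  | _ d ih =>
    by_cases hlm : l = m
    · subst hlm; exact ⟨_, .nil l⟩
    · obtain ⟨n, hn, hnm⟩ := exists_pCovers_le h hlm
      have hs : ptnSize n ≤ ptnSize m :=
        Finsupp.sum_le_sum_index (f₁ := n.1) (f₂ := m.1) hnm
          (fun _ _ => monotone_id) (fun _ _ => rfl)
      have := hn.2
      obtain ⟨x, hx⟩ := ih _ (by omega) hnm rfl
      exact ⟨_, .cons hn hx⟩

variable {K}

/-- Parallel paths have the same class in `F`. -/
theorem IsPath.unique {l m : Ptn} {x y : FAlg K} (hx : IsPath K l m x) (hy : IsPath K l m y) :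
    x = y := by
  induction hd : ptnSize m - ptnSize l using Nat.strong_induction_on generalizing l x y with
  | _ d ih =>
    cases hx with
    | nil =>
      cases hy with
      | nil => rfl
      | cons h hy => have := hy.size_le; have := h.2; omega
    | @cons _ n _ x hn hx =>
      cases hy with
      | nil => have := hx.size_le; have := hn.2; omega
      | @cons _ k _ y hk hy =>
        have h1 := hn.2
        have h2 := hk.2
        have h3 := hx.size_le
        by_cases hnk : n = k
        · subst hnk
          rw [ih _ (by omega) hx hy rfl]
        · obtain ⟨e, hne, hke, het⟩ := exists_square hn hk hnk hx.le hy.le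
          obtain ⟨z, hz⟩ := exists_isPath K het
          rw [ih _ (by omega) hx (.cons hne hz) rfl, ih _ (by omega) hy (.cons hke hz) rfl,
            ← mul_assoc, ← mul_assoc, aP_mul_aP_square K hn hk hne hke hnk]

theorem IsPath.eq_zero {l m : Ptn} {x : FAlg K} (hx : IsPath K l m x)
    (hlm : ¬ Interlaced l m) : x = 0 := by
  induction hd : ptnSize m - ptnSize l using Nat.strong_induction_on generalizing l x with
  | _ d ih =>
    cases hx with
    | nil => exact absurd (fun i => ⟨le_rfl, ptn_antitone _ i⟩) hlm
    | @cons _ n _ x hn hx =>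
      have hs := hn.2
      have hs' := hx.size_le
      by_cases hnm : Interlaced n m
      swap
      · rw [ih _ (by omega) hx hnm rfl, mul_zero]
      obtain ⟨i, hi, hi'⟩ := pCovers_iff_row.1 hn
      have hlt : l.1 i < m.1 (i + 1) := by
        by_contra! hc
        refine hlm fun j => ⟨(hn.1 j).trans (hx.le j), ?_⟩
        by_cases hj : j = i
        · rw [hj]; exact hc
        · rw [← hi' j hj]; exact (hnm j).2
      have hl := ptn_antitone l i
      have hni : n.1 (i + 1) = l.1 (i + 1) := hi' _ (by omega)
      obtain ⟨e, he, he'⟩ := exists_add_box n (i + 1) fun j hj => by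
        obtain rfl : j = i := by omega
        omega
      have hne : PCovers n e := pCovers_iff_row.2 ⟨_, he, he'⟩
      have het : ∀ j, e.1 j ≤ m.1 j := fun j => by
        by_cases hj : j = i + 1
        · rw [hj, he]; omega
        · rw [he' j hj]; exact hx.le j
      obtain ⟨z, hz⟩ := exists_isPath K het
      have hei : e.1 i = l.1 i + 1 := by rw [he' i (by omega), hi]
      rw [hx.unique (.cons hne hz), ← mul_assoc]
      by_cases heq : l.1 i = l.1 (i + 1)
      · have hcol : SameColumn l e := ⟨i, hei, by omega, heq, fun r h1 h2 => by
          rw [he' r h2, hi' r h1]⟩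
        rw [aP_mul_aP_column K hn hne hcol, zero_mul]
      · obtain ⟨k, hk, hk'⟩ := exists_add_box l (i + 1) fun j hj => by
          obtain rfl : j = i := by omega
          omega
        have hlk : PCovers l k := pCovers_iff_row.2 ⟨_, hk, hk'⟩
        have hki : k.1 i = l.1 i := hk' i (by omega)
        have hke : PCovers k e := pCovers_iff_row.2 ⟨i, by omega, fun j hj => by
          by_cases hj' : j = i + 1
          · subst hj'; omega
          · rw [he' j hj', hi' j hj, hk' j hj']⟩
        have hnk : n ≠ k := by rintro rfl; omega
        have hkm : ¬ Interlaced k m := fun h => by have := (h i).2; omega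
        rw [aP_mul_aP_square K hn hlk hne hke hnk, mul_assoc,
          ih _ (by have := hlk.2; omega) (.cons hke hz) hkm rfl, mul_zero]

/-- The classes of paths ending at `m` span a left ideal. -/
theorem mul_mem_span_isPath {m : Ptn} (a : FAlg K) {y : FAlg K}
    (hy : y ∈ Submodule.span K {x | ∃ l, IsPath K l m x}) :
    a * y ∈ Submodule.span K {x | ∃ l, IsPath K l m x} := by
  obtain ⟨a, rfl⟩ := RingQuot.mkAlgHom_surjective K (FRel K) a
  induction a using FreeAlgebra.induction generalizing y with
  | grade0 r =>
    rw [AlgHom.commutes, ← Algebra.smul_def]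
    exact Submodule.smul_mem _ _ hy
  | grade1 g =>
    induction hy using Submodule.span_induction with
    | zero => simp
    | add u v _ _ hu hv => rw [mul_add]; exact add_mem hu hv
    | smul r u _ hu => rw [mul_smul_comm]; exact Submodule.smul_mem _ _ hu
    | mem y hy =>
      obtain ⟨l, hy⟩ := hy
      cases g with
      | idem n =>
        change eP K n * y ∈ _
        by_cases hn : n = l
        · rw [hn, hy.eP_mul]
          exact Submodule.subset_span ⟨l, hy⟩
        · rw [← hy.eP_mul, ← mul_assoc, eP_mul_eP_of_ne K hn, zero_mul]
          exact zero_mem _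
      | arr k n =>
        change aP K k n * y ∈ _
        by_cases hn : n = l
        · subst hn
          by_cases hc : PCovers k n
          · exact Submodule.subset_span ⟨k, .cons hc hy⟩
          · rw [aP_eq_zero K hc, zero_mul]
            exact zero_mem _
        · rw [← hy.eP_mul, ← aP_mul_eP, mul_assoc, ← mul_assoc (eP K n),
            eP_mul_eP_of_ne K hn, zero_mul, mul_zero]
          exact zero_mem _
  | mul a b ha hb =>
    rw [map_mul, mul_assoc]
    exact ha (hb hy)
  | add a b ha hb =>
    rw [map_add, add_mul]
    exact add_mem (ha hy) (hb hy)

theorem Fspace_eq_span (l m : Ptn) :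
    Fspace K l m = Submodule.span K {x | IsPath K l m x} := by
  apply le_antisymm
  · rintro _ ⟨x, rfl⟩
    have hx := mul_mem_span_isPath x (Submodule.subset_span ⟨m, IsPath.nil m⟩)
    change eP K l * (x * eP K m) ∈ _
    generalize x * eP K m = y at hx ⊢
    induction hx using Submodule.span_induction with
    | zero => simp
    | add u v _ _ hu hv => rw [mul_add]; exact add_mem hu hv
    | smul r u _ hu => rw [mul_smul_comm]; exact Submodule.smul_mem _ _ hu
    | mem y hy =>
      obtain ⟨k, hy⟩ := hy
      by_cases hk : l = k
      · subst hk
        rw [hy.eP_mul]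
        exact Submodule.subset_span hy
      · rw [← hy.eP_mul, ← mul_assoc, eP_mul_eP_of_ne K hk, zero_mul]
        exact zero_mem _
  · refine Submodule.span_le.2 fun x hx => ⟨x, ?_⟩
    change eP K l * (x * eP K m) = x
    rw [hx.mul_eP, hx.eP_mul]

variable (K)

open Classical in
/-- The matrix unit at `(l, m)` acting on functions on partitions. -/
noncomputable def matUnit (l m : Ptn) : Module.End K (Ptn → K) :=
  LinearMap.single K (fun _ => K) l ∘ₗ LinearMap.proj m

theorem matUnit_mul_matUnit (l m n : Ptn) :
    matUnit K l m * matUnit K m n = matUnit K l n := by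
  ext f x
  simp [matUnit, Module.End.mul_apply]

theorem matUnit_mul_matUnit_of_ne {l m k n : Ptn} (h : m ≠ k) :
    matUnit K l m * matUnit K k n = 0 := by
  refine LinearMap.ext fun f => ?_
  simp [matUnit, Module.End.mul_apply, h]

theorem matUnit_ne_zero (l m : Ptn) : matUnit K l m ≠ 0 := by
  intro h
  have := congrFun (LinearMap.congr_fun h fun _ => 1) l
  simp [matUnit] at this

open Classical in
/-- The action of the generators of `F` on the left module with basis indexed by the
partitions interlaced under `t`. -/
noncomputable def genAction (t : Ptn) : FGen → Module.End K (Ptn → K)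
  | .idem l => matUnit K l l
  | .arr l m => if PCovers l m ∧ Interlaced l t ∧ Interlaced m t then matUnit K l m else 0

theorem lift_genAction_rel (t : Ptn) {a b : FreeAlgebra K FGen} (h : FRel K a b) :
    FreeAlgebra.lift K (genAction K t) a = FreeAlgebra.lift K (genAction K t) b := by
  cases h with
  | idem_sq l => simp [genAction, matUnit_mul_matUnit]
  | idem_orth l m h => simp [genAction, matUnit_mul_matUnit_of_ne K h]
  | arr_not_cover l m h => simp [genAction, h]
  | idem_arr l m => simp [genAction, matUnit_mul_matUnit]
  | idem_arr_ne l m n h => simp [genAction, matUnit_mul_matUnit_of_ne K h]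
  | arr_idem l m => simp [genAction, matUnit_mul_matUnit]
  | arr_idem_ne l m n h => simp [genAction, matUnit_mul_matUnit_of_ne K h.symm]
  | square l m n e h1 h2 h3 h4 h =>
    by_cases hle : Interlaced l t ∧ Interlaced e t
    · have hm := hle.1.of_le_of_le h1.1 fun i => (h3.1 i).trans (hle.2 i).1
      have hn := hle.1.of_le_of_le h2.1 fun i => (h4.1 i).trans (hle.2 i).1
      simp [genAction, h1, h2, h3, h4, hm, hn, hle, matUnit_mul_matUnit]
    · rcases not_and_or.1 hle with hl | he
      · simp [genAction, hl]
      · simp [genAction, he]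
  | column l m e h1 h2 h =>
    have hle : ¬ (Interlaced l t ∧ Interlaced e t) := by
      rintro ⟨hl, he⟩
      obtain ⟨i, -, h4, h5, -⟩ := h
      have := (hl i).2
      have := (he (i + 1)).1
      omega
    rcases not_and_or.1 hle with hl | he
    · simp [genAction, hl]
    · simp [genAction, he]

/-- The representation of `F` on the partitions interlaced under `t`. -/
noncomputable def interlacedRep (t : Ptn) : FAlg K →ₐ[K] Module.End K (Ptn → K) :=
  RingQuot.liftAlgHom K ⟨FreeAlgebra.lift K (genAction K t), fun _ _ => lift_genAction_rel K t⟩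

theorem interlacedRep_eP (t l : Ptn) : interlacedRep K t (eP K l) = matUnit K l l := by
  simp [interlacedRep, eP, genAction]

theorem interlacedRep_aP {t l m : Ptn} (h : PCovers l m) (hl : Interlaced l t)
    (hm : Interlaced m t) : interlacedRep K t (aP K l m) = matUnit K l m := by
  simp [interlacedRep, aP, genAction, h, hl, hm]

variable {K}

theorem IsPath.interlacedRep_eq {l m : Ptn} {x : FAlg K} (hx : IsPath K l m x)
    (h : Interlaced l m) : interlacedRep K m x = matUnit K l m := by
  induction hx with
  | nil l => exact interlacedRep_eP K l l
  | cons hc hx ih =>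
    have hn := h.of_le_of_le hc.1 hx.le
    rw [map_mul, interlacedRep_aP K hc h hn, ih hn, matUnit_mul_matUnit]

theorem IsPath.ne_zero {l m : Ptn} {x : FAlg K} (hx : IsPath K l m x) (h : Interlaced l m) :
    x ≠ 0 := by
  rintro rfl
  exact matUnit_ne_zero K l m (by rw [← hx.interlacedRep_eq h, map_zero])

/-- Lemma 2.6: `(λ)F(μ)` is one-dimensional if `λ` is interlaced under `μ`
(`μ_i ≥ λ_i ≥ μ_{i+1}` for all `i`), and zero otherwise. -/
theorem Fspace_dim (K : Type) [Field K] [CharZero K] (l m : Ptn) :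
    (Interlaced l m → Module.finrank K (Fspace K l m) = 1) ∧
    (¬ Interlaced l m → Fspace K l m = ⊥) := by
  rw [Fspace_eq_span]
  refine ⟨fun h => ?_, fun h => Submodule.span_eq_bot.2 fun x hx => IsPath.eq_zero hx h⟩
  obtain ⟨x, hx⟩ := exists_isPath K fun i => (h i).1
  have hset : {y | IsPath K l m y} = {x} :=
    Set.eq_singleton_iff_unique_mem.2 ⟨hx, fun y hy => IsPath.unique hy hx⟩
  rw [hset, finrank_span_singleton (hx.ne_zero h)]
end
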